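/- arXiv:1012.3954 — 9 statements merged into one kernel-verified Lean document; each statement's English description precedes it below -/
import Mathlib

section
/- Let I = (μ₁, μ₂) be a nonempty open interval of ℝ (with −∞ ≤ μ₁ < μ₂ ≤ ∞), let (λ_k)_{k∈ℕ} be a sequence of points of I, let (c_k)_{k∈ℕ} be a sequence of strictly positive real numbers, and let X₂ ⊆ I be an at most countable set. Assume that for every λ ∈ I not belonging to {λ_k : k ∈ ℕ} ∪ X₂ one has ∑_{k} c_k/(λ_k − λ)² < ∞. Then the intersection of the closure of {λ_k : k ∈ ℕ} with I is nowhere dense in I. -/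
open Set Filter MeasureTheory
open scoped ENNReal

/-- `X` is nowhere dense in the interval `I`: every nonempty open subinterval of `I`
contains a nonempty open subinterval disjoint from `X`. -/
def NowhereDenseIn (X I : Set ℝ) : Prop :=
  ∀ a b : ℝ, a < b → Set.Ioo a b ⊆ I →
    ∃ c d : ℝ, c < d ∧ Set.Ioo c d ⊆ Set.Ioo a b ∧ X ∩ Set.Ioo c d = ∅

/-- If the terms `c k / (l k - x) ^ 2` have a finite sum at `x ∉ range l`, then `x` lies in only
finitely many of the intervals `(l k - √(c k), l k + √(c k))`. -/
theorem eventually_le_sq_sub_of_tsum_lt_top {l c : ℕ → ℝ} {x : ℝ} (hx : x ∉ Set.range l)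
    (h : (∑' k, ENNReal.ofReal (c k) / ENNReal.ofReal ((l k - x) ^ 2)) < ∞) :
    ∀ᶠ k in atTop, c k ≤ (l k - x) ^ 2 := by
  have ht := ENNReal.tendsto_cofinite_zero_of_tsum_ne_top h.ne
  rw [Nat.cofinite_eq_atTop] at ht
  filter_upwards [ht.eventually_lt_const one_pos] with k hk
  have hpos : 0 < (l k - x) ^ 2 := by
    have : l k - x ≠ 0 := fun h0 => hx ⟨k, by linarith⟩
    positivity
  have hpos' : ENNReal.ofReal ((l k - x) ^ 2) ≠ 0 :=
    (ENNReal.ofReal_pos.2 hpos).ne'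
  rw [ENNReal.div_lt_iff (Or.inl hpos') (Or.inl ENNReal.ofReal_ne_top), one_mul] at hk
  exact (ENNReal.ofReal_lt_ofReal_iff hpos).1 hk |>.le

/-- If a sequence meets every open subinterval of `(a, b)`, then each of its tails meets every
nonempty open subset of `(a, b)`. -/
theorem exists_ge_mem_of_forall_Ioo {l : ℕ → ℝ} {a b : ℝ}
    (h : ∀ u v : ℝ, u < v → Set.Ioo u v ⊆ Set.Ioo a b → ∃ k, l k ∈ Set.Ioo u v)
    {O : Set ℝ} (hO : IsOpen O) (hne : O.Nonempty) (hOab : O ⊆ Set.Ioo a b) (n : ℕ) :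
    ∃ k, n ≤ k ∧ l k ∈ O := by
  have hfin : (l '' Set.Iio n).Finite := (Set.finite_Iio n).image l
  obtain ⟨y, hyO, hy⟩ := hfin.countable.dense_compl ℝ |>.inter_open_nonempty O hO hne
  obtain ⟨u, v, huv, hsub⟩ := mem_nhds_iff_exists_Ioo_subset.1
    ((hO.inter hfin.isClosed.isOpen_compl).mem_nhds ⟨hyO, hy⟩)
  obtain ⟨k, hk⟩ := h u v (huv.1.trans huv.2) fun z hz => hOab (hsub hz).1
  exact ⟨k, not_lt.1 fun hkn => (hsub hk).2 ⟨k, hkn, rfl⟩, (hsub hk).1⟩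

/-- If a sequence meets every open subinterval of `(a, b)` and `c` is positive, then outside any
countable set there is a point of `(a, b)` lying in infinitely many of the intervals
`(l k - √(c k), l k + √(c k))`. -/
theorem exists_frequently_sq_sub_lt {l c : ℕ → ℝ} (hc : ∀ k, 0 < c k) {a b : ℝ} (hab : a < b)
    (h : ∀ u v : ℝ, u < v → Set.Ioo u v ⊆ Set.Ioo a b → ∃ k, l k ∈ Set.Ioo u v)
    {S : Set ℝ} (hS : S.Countable) :
    ∃ x ∈ Set.Ioo a b, x ∉ S ∧ ∃ᶠ k in atTop, (l k - x) ^ 2 < c k := by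
  let V : ℕ → Set ℝ := fun n =>
    (⋃ k, ⋃ (_ : n ≤ k), {x | (l k - x) ^ 2 < c k}) ∪ (closure (Set.Ioo a b))ᶜ
  have hVo : ∀ n, IsOpen (V n) := fun n =>
    (isOpen_iUnion fun k => isOpen_iUnion fun _ =>
      isOpen_lt (by fun_prop) continuous_const).union isClosed_closure.isOpen_compl
  have hVd : ∀ n, Dense (V n) := by
    intro n
    refine dense_iff_inter_open.2 fun O hO hne => ?_
    by_cases hOab : (O ∩ Set.Ioo a b).Nonempty
    · obtain ⟨k, hnk, hk⟩ := exists_ge_mem_of_forall_Ioo h (hO.inter isOpen_Ioo) hOab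
        Set.inter_subset_right n
      exact ⟨l k, hk.1, Or.inl (Set.mem_iUnion₂.2 ⟨k, hnk, by simpa using hc k⟩)⟩
    · obtain ⟨y, hy⟩ := hne
      have hd : Disjoint O (closure (Set.Ioo a b)) :=
        (Set.disjoint_iff_inter_eq_empty.2 (Set.not_nonempty_iff_eq_empty.1 hOab)).closure_right hO
      exact ⟨y, hy, Or.inr (Set.disjoint_left.1 hd hy)⟩
  have hG : Dense ((⋂ n, V n) ∩ Sᶜ) :=
    (dense_iInter_of_isOpen hVo hVd).inter_of_Gδ (.iInter_of_isOpen hVo) hS.isGδ_compl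
      (hS.dense_compl ℝ)
  obtain ⟨x, hx, hxV, hxS⟩ := hG.inter_open_nonempty _ isOpen_Ioo (Set.nonempty_Ioo.2 hab)
  refine ⟨x, hx, hxS, frequently_atTop.2 fun n => ?_⟩
  rcases Set.mem_iInter.1 hxV n with hxn | hxn
  · obtain ⟨k, hnk, hk⟩ := Set.mem_iUnion₂.1 hxn
    exact ⟨k, hnk, hk⟩
  · exact absurd (subset_closure hx) hxn

/-- if `(λ_k)` is a sequence in a nonempty open interval `I`, `(c_k)` are
strictly positive reals, `X₂ ⊆ I` is at most countable and
`∑_k c_k/(λ_k − λ)² < ∞` for every `λ ∈ I` outside `{λ_k} ∪ X₂`, then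
`closure {λ_k} ∩ I` is nowhere dense in `I`. -/
theorem stmt0 (μ₁ μ₂ : EReal) (hμ : μ₁ < μ₂)
    (I : Set ℝ) (hIdef : I = {x : ℝ | μ₁ < (x : EReal) ∧ (x : EReal) < μ₂})
    (l : ℕ → ℝ) (hl : ∀ k, l k ∈ I)
    (c : ℕ → ℝ) (hc : ∀ k, 0 < c k)
    (X₂ : Set ℝ) (hX₂I : X₂ ⊆ I) (hX₂ : X₂.Countable)
    (hsum : ∀ x ∈ I, x ∉ Set.range l ∪ X₂ →
      (∑' k, ENNReal.ofReal (c k) / ENNReal.ofReal ((l k - x) ^ 2)) < ∞) :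
    NowhereDenseIn (closure (Set.range l) ∩ I) I := by
  intro a b hab habI
  by_contra! hne
  have hmeet : ∀ u v : ℝ, u < v → Set.Ioo u v ⊆ Set.Ioo a b → ∃ k, l k ∈ Set.Ioo u v := by
    intro u v huv hsub
    obtain ⟨y, hy, hyuv⟩ := hne u v huv hsub
    obtain ⟨_, hz, k, rfl⟩ := mem_closure_iff.1 hy.1 _ isOpen_Ioo hyuv
    exact ⟨k, hz⟩
  obtain ⟨x, hx, hxS, hfreq⟩ :=
    exists_frequently_sq_sub_lt hc hab hmeet ((Set.countable_range l).union hX₂)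
  refine hfreq ?_
  filter_upwards [eventually_le_sq_sub_of_tsum_lt_top (fun hr => hxS (Or.inl hr))
    (hsum x (habI hx) hxS)] with k hk
  exact not_lt.2 hk
end

section
/- Let (λ_k)_{k∈ℕ} be a sequence of real numbers that is dense in some nonempty open interval J ⊆ ℝ, and let (c_k)_{k∈ℕ} be any sequence of strictly positive real numbers. Then the set {λ ∈ J : ∑_k c_k/(λ_k − λ)² = ∞} is uncountable. -/
open Set Filter MeasureTheory
open scoped ENNReal

/-- The series `∑_k c_k/(l_k − x)²` is lower semicontinuous in `x`. -/
lemma lowerSemicontinuous_tsum_div_sq (l c : ℕ → ℝ) :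
    LowerSemicontinuous fun x : ℝ =>
      ∑' k, ENNReal.ofReal (c k) / ENNReal.ofReal ((l k - x) ^ 2) := by
  refine lowerSemicontinuous_tsum fun k => Continuous.lowerSemicontinuous ?_
  simp only [div_eq_mul_inv]
  refine (ENNReal.continuous_const_mul ENNReal.ofReal_ne_top).comp (continuous_inv.comp ?_)
  exact ENNReal.continuous_ofReal.comp (by fun_prop)

/-- The series `∑_k c_k/(l_k − x)²` is infinite at each of the points `l_k`. -/
lemma tsum_div_sq_eq_top (l c : ℕ → ℝ) (hc : ∀ k, 0 < c k) (j : ℕ) :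
    ∑' k, ENNReal.ofReal (c k) / ENNReal.ofReal ((l k - l j) ^ 2) = ∞ := by
  refine ENNReal.tsum_eq_top_of_eq_top ⟨j, ?_⟩
  simp [ENNReal.div_eq_top, hc j]

/-- if `(λ_k)` is a sequence of reals dense in a nonempty open interval
`J = (a, b)` and `(c_k)` are strictly positive reals, then the set of `λ ∈ J` where
`∑_k c_k/(λ_k − λ)² = ∞` (sum in `[0, ∞]`, with `c_k/0 = ∞`) is uncountable. -/
theorem stmt1 (a b : ℝ) (hab : a < b)
    (l : ℕ → ℝ) (hdense : Set.Ioo a b ⊆ closure (Set.range l))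
    (c : ℕ → ℝ) (hc : ∀ k, 0 < c k) :
    ¬ Set.Countable {x : ℝ | x ∈ Set.Ioo a b ∧
      (∑' k, ENNReal.ofReal (c k) / ENNReal.ofReal ((l k - x) ^ 2)) = ∞} := by
  intro hS
  set F : ℝ → ℝ≥0∞ := fun x => ∑' k, ENNReal.ofReal (c k) / ENNReal.ofReal ((l k - x) ^ 2)
  let V : ℕ → Set ℝ := fun n => F ⁻¹' Ioi (n : ℝ≥0∞) ∪ (Icc a b)ᶜ
  have hVo (n : ℕ) : IsOpen (V n) :=
    ((lowerSemicontinuous_tsum_div_sq l c).isOpen_preimage _).union isClosed_Icc.isOpen_compl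
  have hVd (n : ℕ) : Dense (V n) := by
    have hl : range l ⊆ V n := by
      rintro _ ⟨j, rfl⟩
      left
      change (n : ℝ≥0∞) < F (l j)
      rw [show F (l j) = ∞ from tsum_div_sq_eq_top l c hc j]
      exact ENNReal.natCast_lt_top n
    intro x
    by_cases hx : x ∈ Icc a b
    · rw [← closure_Ioo hab.ne] at hx
      exact closure_minimal (hdense.trans (closure_mono hl)) isClosed_closure hx
    · exact subset_closure (Or.inr hx)
  have hD := (dense_iInter_of_isOpen hVo hVd).inter_of_Gδ
    (.iInter_of_isOpen hVo) hS.isGδ_compl (hS.dense_compl ℝ)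
  obtain ⟨x, hxJ, hxV, hxS⟩ := hD.inter_open_nonempty _ isOpen_Ioo (nonempty_Ioo.2 hab)
  refine hxS ⟨hxJ, ENNReal.eq_top_of_forall_nnreal_le fun r => ?_⟩
  obtain ⟨n, hn⟩ := exists_nat_ge r
  have hx : (n : ℝ≥0∞) < F x :=
    (mem_iInter.1 hxV n).resolve_right fun h => h (Ioo_subset_Icc_self hxJ)
  exact le_trans (by exact_mod_cast hn) hx.le
end

section
/- Let μ be a Borel measure on ℝ, finite on bounded Borel sets, such that ∫_ℝ (1 + t²)^{-1} dμ(t) < ∞, and define φ(z) = ∫_ℝ (1/(t − z) − t/(1 + t²)) dμ(t) for z ∈ ℂ with Im z ≠ 0. Fix λ ∈ ℝ. Then the limit lim_{y → 0⁺} (1/y) · Im φ(λ + iy) exists in the extended nonnegative reals [0, ∞] and equals ∫_ℝ (t − λ)^{-2} dμ(t); in particular, lim_{y → 0⁺} (1/y) · Im φ(λ + iy) < ∞ if and only if ∫_ℝ (t − λ)^{-2} dμ(t) < ∞. -/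
open Set Filter MeasureTheory
open scoped ENNReal

/-- The Herglotz (Nevanlinna) transform `φ(z) = ∫ (1/(t − z) − t/(1 + t²)) dμ(t)`. -/
noncomputable def herglotz (μ : Measure ℝ) (z : ℂ) : ℂ :=
  ∫ t, (((t : ℂ) - z)⁻¹ - ((t / (1 + t ^ 2) : ℝ) : ℂ)) ∂μ

/-- For non-real `z`, the integrand of the Herglotz transform equals
`(z + (1 + z²)/(t − z))/(1 + t²)`. -/
theorem herglotz_integrand_eq {z : ℂ} (hz : z.im ≠ 0) (t : ℝ) :
    ((t : ℂ) - z)⁻¹ - ((t / (1 + t ^ 2) : ℝ) : ℂ) =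
      (z + (1 + z ^ 2) * ((t : ℂ) - z)⁻¹) * (((1 + t ^ 2)⁻¹ : ℝ) : ℂ) := by
  have h1 : (t : ℂ) - z ≠ 0 := fun h => hz (by simpa using congrArg Complex.im h)
  have h2 : (1 : ℂ) + (t : ℂ) ^ 2 ≠ 0 := by
    have h3 : (1 : ℝ) + t ^ 2 ≠ 0 := by positivity
    exact_mod_cast h3
  push_cast
  field_simp
  ring

theorem integrable_inv_one_add_sq_of_lintegral_lt_top {μ : Measure ℝ}
    (hint : (∫⁻ t, ENNReal.ofReal ((1 + t ^ 2)⁻¹) ∂μ) < ∞) :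
    Integrable (fun t : ℝ => (1 + t ^ 2)⁻¹) μ := by
  refine ⟨by fun_prop, ?_⟩
  rwa [hasFiniteIntegral_iff_ofReal (ae_of_all _ fun t => by positivity)]

theorem integrable_herglotz_integrand {μ : Measure ℝ}
    (hint : (∫⁻ t, ENNReal.ofReal ((1 + t ^ 2)⁻¹) ∂μ) < ∞) {z : ℂ} (hz : z.im ≠ 0) :
    Integrable (fun t : ℝ => ((t : ℂ) - z)⁻¹ - ((t / (1 + t ^ 2) : ℝ) : ℂ)) μ := by
  simp_rw [herglotz_integrand_eq hz]
  refine (integrable_inv_one_add_sq_of_lintegral_lt_top hint).ofReal.bdd_mul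
    (c := ‖z‖ + ‖1 + z ^ 2‖ * |z.im|⁻¹) (by fun_prop) (ae_of_all _ fun t => ?_)
  refine (norm_add_le _ _).trans ?_
  rw [norm_mul, norm_inv]
  have h : |z.im| ≤ ‖(t : ℂ) - z‖ := by
    simpa using Complex.abs_im_le_norm ((t : ℂ) - z)
  have : 0 < |z.im| := abs_pos.2 hz
  gcongr

/-- The imaginary part of the Herglotz transform is a Poisson-type integral. -/
theorem ofReal_inv_mul_herglotz_im {μ : Measure ℝ}
    (hint : (∫⁻ t, ENNReal.ofReal ((1 + t ^ 2)⁻¹) ∂μ) < ∞) (lam : ℝ) {y : ℝ} (hy : 0 < y) :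
    ENNReal.ofReal ((1 / y) * (herglotz μ ((lam : ℂ) + y * Complex.I)).im) =
      ∫⁻ t, (ENNReal.ofReal ((t - lam) ^ 2 + y ^ 2))⁻¹ ∂μ := by
  have hI := integrable_herglotz_integrand hint
    (z := (lam : ℂ) + y * Complex.I) (by simpa using hy.ne')
  have him (t : ℝ) : (1 / y) * (((t : ℂ) - (lam + y * Complex.I))⁻¹ -
      ((t / (1 + t ^ 2) : ℝ) : ℂ)).im = ((t - lam) ^ 2 + y ^ 2)⁻¹ := by
    rw [Complex.sub_im, Complex.ofReal_im, Complex.inv_im, Complex.normSq_apply]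
    simp only [Complex.sub_im, Complex.sub_re, Complex.add_im, Complex.add_re, Complex.mul_im,
      Complex.mul_re, Complex.ofReal_im, Complex.ofReal_re, Complex.I_im, Complex.I_re]
    have : (t - lam) ^ 2 + y ^ 2 ≠ 0 := by positivity
    ring_nf at this ⊢
    field_simp
  have him_int : (herglotz μ ((lam : ℂ) + y * Complex.I)).im =
      ∫ t, (((t : ℂ) - (lam + y * Complex.I))⁻¹ - ((t / (1 + t ^ 2) : ℝ) : ℂ)).im ∂μ :=
    (integral_im hI).symm
  have hIm := hI.im.const_mul (1 / y)
  simp only [RCLike.im_eq_complex_im, him] at hIm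
  rw [him_int, ← integral_const_mul]
  simp_rw [him]
  rw [ofReal_integral_eq_lintegral_ofReal hIm (ae_of_all _ fun t => by positivity)]
  exact lintegral_congr fun t => ENNReal.ofReal_inv_of_pos (by positivity)

theorem tendsto_lintegral_inv_sq_add_sq (μ : Measure ℝ) (lam : ℝ) :
    Tendsto (fun y : ℝ => ∫⁻ t, (ENNReal.ofReal ((t - lam) ^ 2 + y ^ 2))⁻¹ ∂μ)
      (nhds 0) (nhds (∫⁻ t, (ENNReal.ofReal ((t - lam) ^ 2))⁻¹ ∂μ)) := by
  refine tendsto_of_seq_tendsto fun u hu => ?_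
  refine tendsto_of_le_liminf_of_limsup_le ?_ ?_
  · refine le_trans (lintegral_mono fun t => ?_) (lintegral_liminf_le fun n => by fun_prop)
    refine (Tendsto.liminf_eq ?_).ge
    have hc : Continuous fun y : ℝ => ENNReal.ofReal ((t - lam) ^ 2 + y ^ 2) :=
      ENNReal.continuous_ofReal.comp (by fun_prop)
    simpa [Function.comp_def] using (hc.tendsto 0).comp hu
  · refine limsup_le_of_le (h := Eventually.of_forall fun n => lintegral_mono fun t => ?_)
    gcongr
    exact le_add_of_nonneg_right (sq_nonneg _)

/-- for a Borel measure `μ` on `ℝ`, finite on bounded Borel sets and with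
`∫ (1+t²)⁻¹ dμ < ∞`, and any `λ ∈ ℝ`, the limit `lim_{y→0⁺} (1/y)·Im φ(λ + iy)` exists
in `[0, ∞]` and equals `∫ (t − λ)⁻² dμ(t)`; in particular the limit is finite iff
`∫ (t − λ)⁻² dμ(t) < ∞`. -/
theorem stmt5 (μ : Measure ℝ)
    (hfin : ∀ s : Set ℝ, Bornology.IsBounded s → MeasurableSet s → μ s < ∞)
    (hint : (∫⁻ t, ENNReal.ofReal ((1 + t ^ 2)⁻¹) ∂μ) < ∞)
    (lam : ℝ) :
    Tendsto (fun y : ℝ =>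
        ENNReal.ofReal ((1 / y) * (herglotz μ ((lam : ℂ) + y * Complex.I)).im))
      (nhdsWithin 0 (Set.Ioi 0))
      (nhds (∫⁻ t, (ENNReal.ofReal ((t - lam) ^ 2))⁻¹ ∂μ)) ∧
    ((∃ L : ℝ≥0∞, L < ∞ ∧
        Tendsto (fun y : ℝ =>
            ENNReal.ofReal ((1 / y) * (herglotz μ ((lam : ℂ) + y * Complex.I)).im))
          (nhdsWithin 0 (Set.Ioi 0)) (nhds L)) ↔
      (∫⁻ t, (ENNReal.ofReal ((t - lam) ^ 2))⁻¹ ∂μ) < ∞) := by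
  have hlim : Tendsto (fun y : ℝ =>
        ENNReal.ofReal ((1 / y) * (herglotz μ ((lam : ℂ) + y * Complex.I)).im))
      (nhdsWithin 0 (Set.Ioi 0))
      (nhds (∫⁻ t, (ENNReal.ofReal ((t - lam) ^ 2))⁻¹ ∂μ)) :=
    ((tendsto_lintegral_inv_sq_add_sq μ lam).mono_left nhdsWithin_le_nhds).congr' <| by
      filter_upwards [self_mem_nhdsWithin] with y hy
      exact (ofReal_inv_mul_herglotz_im hint lam hy).symm
  refine ⟨hlim, ?_, fun h => ⟨_, h, hlim⟩⟩
  rintro ⟨L, hL, hLlim⟩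
  rwa [tendsto_nhds_unique hlim hLlim]
end

section
/- Let μ be a Borel measure on ℝ, finite on bounded Borel sets, such that ∫_ℝ (1 + t²)^{-1} dμ(t) < ∞, and define φ(z) = ∫_ℝ (1/(t − z) − t/(1 + t²)) dμ(t) for z ∈ ℂ with Im z ≠ 0. Fix λ ∈ ℝ and assume ∫_ℝ (t − λ)^{-2} dμ(t) < ∞. Then the function t ↦ 1/(t − λ) − t/(1 + t²) is μ-integrable, the limit φ(λ + i0) := lim_{y → 0⁺} φ(λ + iy) exists, Im φ(λ + i0) = 0, and φ(λ + i0) = ∫_ℝ (1/(t − λ) − t/(1 + t²)) dμ(t). -/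
open Set Filter MeasureTheory
open scoped ENNReal

theorem abs_inv_sub_sub_div_le (a t : ℝ) (h : t ≠ a) :
    |(t - a)⁻¹ - t / (1 + t ^ 2)| ≤ ((t - a) ^ 2)⁻¹ + (1 + a ^ 2) * (1 + t ^ 2)⁻¹ := by
  have hs : t - a ≠ 0 := sub_ne_zero.mpr h
  have ht : 0 < 1 + t ^ 2 := by positivity
  have hprod : (t - a)⁻¹ - t / (1 + t ^ 2) = (t - a)⁻¹ * ((1 + a * t) / (1 + t ^ 2)) := by
    field_simp
    ring
  have hsq : ((1 + a * t) / (1 + t ^ 2)) ^ 2 ≤ (1 + a ^ 2) * (1 + t ^ 2)⁻¹ := by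
    rw [div_pow, ← div_eq_mul_inv, div_le_div_iff₀ (by positivity) ht]
    nlinarith [mul_nonneg ht.le (mul_nonneg ht.le (sq_nonneg (t - a))),
      mul_nonneg ht.le (sq_nonneg (t - a))]
  rw [hprod, ← inv_pow]
  refine le_trans ?_ (add_le_add_right hsq _)
  rw [abs_le]
  constructor <;>
    nlinarith [sq_nonneg ((t - a)⁻¹ + (1 + a * t) / (1 + t ^ 2)),
      sq_nonneg ((t - a)⁻¹ - (1 + a * t) / (1 + t ^ 2)), sq_nonneg (t - a)⁻¹,
      sq_nonneg ((1 + a * t) / (1 + t ^ 2))]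

theorem norm_inv_ofReal_sub_mul_I_sub_inv_le (s y : ℝ) (hs : s ≠ 0) (hy0 : 0 ≤ y)
    (hy1 : y ≤ 1) :
    ‖((s : ℂ) - y * Complex.I)⁻¹ - (s : ℂ)⁻¹‖ ≤ (s ^ 2)⁻¹ := by
  have hle : |s| ≤ ‖(s : ℂ) - y * Complex.I‖ := by
    simpa using Complex.abs_re_le_norm ((s : ℂ) - y * Complex.I)
  have hpos : 0 < |s| := abs_pos.mpr hs
  have hne : (s : ℂ) - y * Complex.I ≠ 0 := norm_pos_iff.mp (hpos.trans_le hle)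
  rw [inv_sub_inv hne (Complex.ofReal_ne_zero.mpr hs), norm_div, norm_mul, Complex.norm_real,
    Real.norm_eq_abs, sub_sub_cancel, norm_mul, Complex.norm_I, Complex.norm_real,
    Real.norm_eq_abs, mul_one, abs_of_nonneg hy0, ← one_div, ← sq_abs s, sq]
  gcongr

theorem integrable_inv_sq_sub {μ : Measure ℝ} {a : ℝ}
    (h : (∫⁻ t, (ENNReal.ofReal ((t - a) ^ 2))⁻¹ ∂μ) < ∞) :
    Integrable (fun t : ℝ => ((t - a) ^ 2)⁻¹) μ := by
  refine ⟨by fun_prop, (lintegral_mono fun t => ?_).trans_lt h⟩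
  rw [Real.enorm_of_nonneg (by positivity)]
  rcases (sq_nonneg (t - a)).eq_or_lt with h0 | h0
  · simp [← h0]
  · rw [ENNReal.ofReal_inv_of_pos h0]

theorem ae_ne_of_lintegral_inv_sq_sub_lt_top {μ : Measure ℝ} {a : ℝ}
    (h : (∫⁻ t, (ENNReal.ofReal ((t - a) ^ 2))⁻¹ ∂μ) < ∞) : ∀ᵐ t ∂μ, t ≠ a := by
  filter_upwards [ae_lt_top (by fun_prop) h.ne] with t ht hta
  simp [hta] at ht

theorem integrable_inv_one_add_sq_of_lintegral {μ : Measure ℝ}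
    (h : (∫⁻ t, ENNReal.ofReal ((1 + t ^ 2)⁻¹) ∂μ) < ∞) :
    Integrable (fun t : ℝ => (1 + t ^ 2)⁻¹) μ := by
  refine ⟨by fun_prop, (lintegral_mono fun t => ?_).trans_lt h⟩
  rw [Real.enorm_of_nonneg (by positivity)]

/-- for a Borel measure `μ` on `ℝ`, finite on bounded Borel sets and with
`∫ (1+t²)⁻¹ dμ < ∞`, if `λ ∈ ℝ` satisfies `∫ (t − λ)⁻² dμ(t) < ∞`, then the function
`t ↦ 1/(t − λ) − t/(1 + t²)` is `μ`-integrable, the boundary value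
`φ(λ + i0) = lim_{y→0⁺} φ(λ + iy)` exists, it equals
`∫ (1/(t − λ) − t/(1 + t²)) dμ(t)` (which is `herglotz μ λ`), and its imaginary part
vanishes. -/
theorem stmt6 (μ : Measure ℝ)
    (hfin : ∀ s : Set ℝ, Bornology.IsBounded s → MeasurableSet s → μ s < ∞)
    (hint : (∫⁻ t, ENNReal.ofReal ((1 + t ^ 2)⁻¹) ∂μ) < ∞)
    (lam : ℝ)
    (hlam : (∫⁻ t, (ENNReal.ofReal ((t - lam) ^ 2))⁻¹ ∂μ) < ∞) :
    Integrable (fun t : ℝ => ((t : ℂ) - (lam : ℂ))⁻¹ - ((t / (1 + t ^ 2) : ℝ) : ℂ)) μ ∧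
    Tendsto (fun y : ℝ => herglotz μ ((lam : ℂ) + y * Complex.I))
      (nhdsWithin 0 (Set.Ioi 0)) (nhds (herglotz μ (lam : ℂ))) ∧
    (herglotz μ (lam : ℂ)).im = 0 := by
  have hA := integrable_inv_sq_sub hlam
  have hB := (integrable_inv_one_add_sq_of_lintegral hint).const_mul (1 + lam ^ 2)
  have hne := ae_ne_of_lintegral_inv_sq_sub_lt_top hlam
  have hcast (t : ℝ) : ((t : ℂ) - (lam : ℂ))⁻¹ - ((t / (1 + t ^ 2) : ℝ) : ℂ)
      = (((t - lam)⁻¹ - t / (1 + t ^ 2) : ℝ) : ℂ) := by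
    push_cast
    rfl
  have hbound (t : ℝ) (ht : t ≠ lam) :
      ‖((t : ℂ) - (lam : ℂ))⁻¹ - ((t / (1 + t ^ 2) : ℝ) : ℂ)‖
        ≤ ((t - lam) ^ 2)⁻¹ + (1 + lam ^ 2) * (1 + t ^ 2)⁻¹ := by
    rw [hcast, Complex.norm_real]
    exact abs_inv_sub_sub_div_le lam t ht
  refine ⟨?_, ?_, ?_⟩
  · exact (hA.add hB).mono' (by fun_prop) (hne.mono hbound)
  · refine tendsto_integral_filter_of_dominated_convergence
      (fun t => ((t - lam) ^ 2)⁻¹ + (((t - lam) ^ 2)⁻¹ + (1 + lam ^ 2) * (1 + t ^ 2)⁻¹))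
      (.of_forall fun y => by fun_prop) ?_ (hA.add (hA.add hB)) ?_
    · filter_upwards [Ioc_mem_nhdsGT (zero_lt_one' ℝ)] with y hy
      filter_upwards [hne] with t ht
      have hdiff := norm_inv_ofReal_sub_mul_I_sub_inv_le (t - lam) y (sub_ne_zero.mpr ht)
        hy.1.le hy.2
      rw [Complex.ofReal_sub, sub_sub] at hdiff
      rw [← sub_add_sub_cancel _ ((t : ℂ) - lam)⁻¹ _]
      exact (norm_add_le _ _).trans (add_le_add hdiff (hbound t ht))
    · filter_upwards [hne] with t ht
      have hz : (t : ℂ) - ((lam : ℂ) + ((0 : ℝ) : ℂ) * Complex.I) ≠ 0 := by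
        simpa [sub_eq_zero] using ht
      have hcont : ContinuousAt (fun y : ℝ => ((t : ℂ) - ((lam : ℂ) + y * Complex.I))⁻¹) 0 :=
        ContinuousAt.inv₀ (f := fun y : ℝ => (t : ℂ) - ((lam : ℂ) + y * Complex.I))
          (by fun_prop) hz
      refine Tendsto.sub_const ?_ _
      simpa using hcont.tendsto.mono_left nhdsWithin_le_nhds
  · simp only [herglotz, hcast]
    rw [integral_complex_ofReal, Complex.ofReal_im]
end

section
/- Let μ be a Borel measure on ℝ, finite on bounded Borel sets, with ∫_ℝ (1 + t²)^{-1} dμ(t) < ∞ and μ(ℝ) = ∞. Let I = (μ₁, μ₂) be a nonempty open interval of ℝ (with −∞ ≤ μ₁ < μ₂ ≤ ∞) and assume that the set of λ ∈ I for which μ({λ}) > 0 or ∫_ℝ (t − λ)^{-2} dμ(t) = ∞ is at most countable. Then the restriction of μ to I is purely atomic: there exists an at most countable set D ⊆ I such that μ(I ∖ D) = 0. -/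
open Set Filter MeasureTheory
open scoped ENNReal

/-- If `∫ (t - lam)⁻² dμ(t) ≤ C`, then any set within distance `r` of `lam` has measure at
most `C r²`. -/
lemma measure_le_of_lintegral_inv_sq_le (μ : Measure ℝ) {lam r : ℝ} (hr : 0 < r) {C : ℝ≥0∞}
    (hC : (∫⁻ t, (ENNReal.ofReal ((t - lam) ^ 2))⁻¹ ∂μ) ≤ C) {s : Set ℝ}
    (hs : ∀ t ∈ s, |t - lam| ≤ r) : μ s ≤ C * ENNReal.ofReal (r ^ 2) := by
  have hmeas : Measurable fun t : ℝ => (ENNReal.ofReal ((t - lam) ^ 2))⁻¹ := by fun_prop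
  have hsub : s ⊆ {t | (ENNReal.ofReal (r ^ 2))⁻¹ ≤ (ENNReal.ofReal ((t - lam) ^ 2))⁻¹} := by
    intro t ht
    refine ENNReal.inv_le_inv.mpr (ENNReal.ofReal_le_ofReal ?_)
    exact sq_le_sq' (by linarith [(abs_le.mp (hs t ht)).1]) (abs_le.mp (hs t ht)).2
  have hle : (ENNReal.ofReal (r ^ 2))⁻¹ * μ s ≤ C :=
    (mul_le_mul_right (measure_mono hsub) _).trans
      ((mul_meas_ge_le_lintegral hmeas _).trans hC)
  have hpos : ENNReal.ofReal (r ^ 2) ≠ 0 := by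
    rw [Ne, ENNReal.ofReal_eq_zero, not_le]
    positivity
  rw [mul_comm, ← div_eq_mul_inv] at hle
  exact (ENNReal.div_le_iff hpos ENNReal.ofReal_ne_top).mp hle

/-- The points of a unit interval at which `∫ (t - lam)⁻² dμ(t)` is at most `C < ∞` form a
`μ`-null set. -/
lemma measure_lintegral_inv_sq_le_inter_Ico (μ : Measure ℝ) (a : ℝ) {C : ℝ≥0∞} (hC : C ≠ ∞) :
    μ ({lam | (∫⁻ t, (ENNReal.ofReal ((t - lam) ^ 2))⁻¹ ∂μ) ≤ C} ∩ Ico a (a + 1)) = 0 := by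
  set E := {lam | (∫⁻ t, (ENNReal.ofReal ((t - lam) ^ 2))⁻¹ ∂μ) ≤ C}
  have key : ∀ m : ℕ, 0 < m → μ (E ∩ Ico a (a + 1)) ≤ C * (m : ℝ≥0∞)⁻¹ := by
    intro m hm
    have hm' : (0 : ℝ) < m := Nat.cast_pos.mpr hm
    let p : ℕ → Set ℝ := fun j => E ∩ Icc (a + j / m) (a + (j + 1) / m)
    have hcover : E ∩ Ico a (a + 1) ⊆ ⋃ j ∈ Finset.range m, p j := by
      rintro x ⟨hxE, hx⟩
      have h0 : 0 ≤ (x - a) * m := mul_nonneg (by linarith [hx.1]) hm'.le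
      have h1 : (x - a) * m < m := by nlinarith [hx.2]
      simp only [mem_iUnion, Finset.mem_range]
      refine ⟨⌊(x - a) * m⌋₊, (Nat.floor_lt h0).mpr h1, hxE, ?_, ?_⟩
      · have := (div_le_iff₀ hm').mpr (Nat.floor_le h0)
        linarith
      · have := (le_div_iff₀ hm').mpr (Nat.lt_floor_add_one ((x - a) * m)).le
        linarith
    have hpiece : ∀ j, μ (p j) ≤ C * ENNReal.ofReal ((1 / m : ℝ) ^ 2) := by
      intro j
      rcases (p j).eq_empty_or_nonempty with h | ⟨lam, hlam⟩
      · simp [h]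
      · refine measure_le_of_lintegral_inv_sq_le μ (by positivity) hlam.1 fun t ht => ?_
        have h := Real.dist_le_of_mem_Icc ht.2 hlam.2
        rw [Real.dist_eq] at h
        refine h.trans_eq ?_
        ring
    calc μ (E ∩ Ico a (a + 1)) ≤ ∑ j ∈ Finset.range m, μ (p j) :=
          (measure_mono hcover).trans (measure_biUnion_finset_le _ _)
      _ ≤ ∑ _j ∈ Finset.range m, C * ENNReal.ofReal ((1 / m : ℝ) ^ 2) :=
          Finset.sum_le_sum fun j _ => hpiece j
      _ = C * (m : ℝ≥0∞)⁻¹ := by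
          rw [Finset.sum_const, Finset.card_range, nsmul_eq_mul, mul_left_comm,
            ← ENNReal.ofReal_natCast, ← ENNReal.ofReal_mul hm'.le,
            ← ENNReal.ofReal_inv_of_pos hm']
          congr 2
          field_simp
  have hlim : Tendsto (fun m : ℕ => C * (m : ℝ≥0∞)⁻¹) atTop (nhds 0) := by
    simpa using ENNReal.Tendsto.const_mul ENNReal.tendsto_inv_nat_nhds_zero (Or.inr hC)
  exact le_antisymm
    (ge_of_tendsto hlim ((eventually_gt_atTop 0).mono fun m hm => key m hm)) zero_le

/-- The points at which `∫ (t - lam)⁻² dμ(t)` is finite form a `μ`-null set. -/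
lemma measure_lintegral_inv_sq_ne_top (μ : Measure ℝ) :
    μ {lam | (∫⁻ t, (ENNReal.ofReal ((t - lam) ^ 2))⁻¹ ∂μ) ≠ ∞} = 0 := by
  refine measure_mono_null (t := ⋃ (n : ℕ) (k : ℤ),
    {lam | (∫⁻ t, (ENNReal.ofReal ((t - lam) ^ 2))⁻¹ ∂μ) ≤ n} ∩ Ico (k : ℝ) (k + 1)) ?_ ?_
  · intro lam hlam
    obtain ⟨n, hn⟩ := ENNReal.exists_nat_gt hlam
    exact mem_iUnion₂.mpr ⟨n, ⌊lam⌋, hn.le, Int.floor_le lam, Int.lt_floor_add_one lam⟩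
  · exact measure_iUnion_null fun n => measure_iUnion_null fun k =>
      measure_lintegral_inv_sq_le_inter_Ico μ k (ENNReal.natCast_ne_top n)

/-- let `μ` be a Borel measure on `ℝ`, finite on bounded Borel sets, with
`∫ (1+t²)⁻¹ dμ < ∞` and `μ(ℝ) = ∞`. If `I = (μ₁, μ₂)` is a nonempty open interval such
that the set of `λ ∈ I` with `μ({λ}) > 0` or `∫ (t − λ)⁻² dμ(t) = ∞` is at most
countable, then the restriction of `μ` to `I` is purely atomic: there is an at most
countable `D ⊆ I` with `μ(I ∖ D) = 0`. -/
theorem stmt7 (μ : Measure ℝ)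
    (hfin : ∀ s : Set ℝ, Bornology.IsBounded s → MeasurableSet s → μ s < ∞)
    (hint : (∫⁻ t, ENNReal.ofReal ((1 + t ^ 2)⁻¹) ∂μ) < ∞)
    (htotal : μ Set.univ = ∞)
    (μ₁ μ₂ : EReal) (hμ : μ₁ < μ₂)
    (I : Set ℝ) (hIdef : I = {x : ℝ | μ₁ < (x : EReal) ∧ (x : EReal) < μ₂})
    (hcnt : Set.Countable {lam : ℝ | lam ∈ I ∧
      (0 < μ {lam} ∨ (∫⁻ t, (ENNReal.ofReal ((t - lam) ^ 2))⁻¹ ∂μ) = ∞)}) :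
    ∃ D : Set ℝ, D ⊆ I ∧ D.Countable ∧ μ (I \ D) = 0 := by
  refine ⟨_, fun _ h => h.1, hcnt, ?_⟩
  refine measure_mono_null ?_ (measure_lintegral_inv_sq_ne_top μ)
  exact fun lam h htop => h.2 ⟨h.1, Or.inr htop⟩
end

section
/- Let μ be a Borel measure on ℝ, finite on bounded Borel sets, with ∫_ℝ (1 + t²)^{-1} dμ(t) < ∞ and μ(ℝ) = ∞. Let I = (μ₁, μ₂) be a nonempty open interval of ℝ (with −∞ ≤ μ₁ < μ₂ ≤ ∞) and assume that the set of λ ∈ I for which μ({λ}) > 0 or ∫_ℝ (t − λ)^{-2} dμ(t) = ∞ is at most countable. Let S = {x ∈ ℝ : every open neighborhood of x has positive μ-measure} be the topological support of μ. Then S ∩ I is nowhere dense in I, and S ∩ I equals the intersection with I of the closure of the set {λ ∈ I : μ({λ}) > 0} of atoms of μ in I. -/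
open Set Filter MeasureTheory
open scoped ENNReal

/-- The extended real valued function `lam ↦ ∫ (t - lam)⁻² dμ(t)`. -/
noncomputable def invSqPotential (μ : Measure ℝ) (lam : ℝ) : ℝ≥0∞ :=
  ∫⁻ t, (ENNReal.ofReal ((t - lam) ^ 2))⁻¹ ∂μ

theorem isClosed_setOf_invSqPotential_le (μ : Measure ℝ) (c : ℝ≥0∞) :
    IsClosed {x | invSqPotential μ x ≤ c} := by
  refine IsSeqClosed.isClosed fun u x hu hx ↦ ?_
  have hlim : ∀ t : ℝ, Tendsto (fun k ↦ (ENNReal.ofReal ((t - u k) ^ 2))⁻¹) atTop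
      (nhds (ENNReal.ofReal ((t - x) ^ 2))⁻¹) := fun t ↦
    tendsto_inv_iff.2 (ENNReal.tendsto_ofReal ((tendsto_const_nhds.sub hx).pow 2))
  calc invSqPotential μ x
      = ∫⁻ t, liminf (fun k ↦ (ENNReal.ofReal ((t - u k) ^ 2))⁻¹) atTop ∂μ :=
        lintegral_congr fun t ↦ (hlim t).liminf_eq.symm
    _ ≤ liminf (fun k ↦ invSqPotential μ (u k)) atTop :=
        lintegral_liminf_le fun k ↦ by fun_prop
    _ ≤ liminf (fun _ : ℕ ↦ c) atTop := liminf_le_liminf (Eventually.of_forall hu)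
    _ = c := liminf_const c

theorem measure_Ico_le_mul_invSqPotential (μ : Measure ℝ) {a b x : ℝ} (hx : x ∈ Ico a b) :
    μ (Ico a b) ≤ ENNReal.ofReal ((b - a) ^ 2) * invSqPotential μ x := by
  have hab : 0 < (b - a) ^ 2 := pow_pos (sub_pos.2 (hx.1.trans_lt hx.2)) 2
  have hsub : Ico a b ⊆
      {t | (ENNReal.ofReal ((b - a) ^ 2))⁻¹ ≤ (ENNReal.ofReal ((t - x) ^ 2))⁻¹} := by
    intro t ht
    refine ENNReal.inv_le_inv.2 (ENNReal.ofReal_le_ofReal ?_)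
    exact sq_le_sq' (by linarith [ht.1, hx.2]) (by linarith [ht.2, hx.1])
  have h := (mul_le_mul_right (measure_mono hsub) _).trans
    (mul_meas_ge_le_lintegral (μ := μ)
      (f := fun t ↦ (ENNReal.ofReal ((t - x) ^ 2))⁻¹) (by fun_prop)
      (ENNReal.ofReal ((b - a) ^ 2))⁻¹)
  rw [mul_comm, ← div_eq_mul_inv] at h
  rw [mul_comm]
  exact (ENNReal.div_le_iff (ENNReal.ofReal_pos.2 hab).ne' ENNReal.ofReal_ne_top).1 h

theorem measure_invSqPotential_le_inter_Ico (μ : Measure ℝ) (n : ℕ) (m : ℝ) :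
    μ ({x | invSqPotential μ x ≤ n} ∩ Ico m (m + 1)) = 0 := by
  have hbound : ∀ N : ℕ, 0 < N →
      μ ({x | invSqPotential μ x ≤ n} ∩ Ico m (m + 1)) ≤ ENNReal.ofReal (n * (N : ℝ)⁻¹) := by
    intro N hN
    have hN' : (0 : ℝ) < N := by exact_mod_cast hN
    let J : ℕ → Set ℝ := fun k ↦ Ico (m + k / N) (m + (k + 1) / N)
    have hcover : {x | invSqPotential μ x ≤ n} ∩ Ico m (m + 1) ⊆
        ⋃ k ∈ Finset.range N, {x | invSqPotential μ x ≤ n} ∩ J k := by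
      rintro x ⟨hx, hxm⟩
      have h0 : 0 ≤ (x - m) * N := mul_nonneg (sub_nonneg.2 hxm.1) hN'.le
      refine mem_iUnion₂.2 ⟨⌊(x - m) * N⌋₊, ?_, hx, ?_, ?_⟩
      · rw [Finset.mem_range, Nat.floor_lt h0]
        nlinarith [hxm.2]
      · have := (div_le_iff₀ hN').2 (Nat.floor_le h0)
        linarith
      · have := (lt_div_iff₀ hN').2 (Nat.lt_floor_add_one ((x - m) * N))
        linarith
    have hJ : ∀ k, μ ({x | invSqPotential μ x ≤ n} ∩ J k) ≤
        ENNReal.ofReal (((N : ℝ)⁻¹) ^ 2 * n) := by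
      intro k
      rcases ({x | invSqPotential μ x ≤ n} ∩ J k).eq_empty_or_nonempty with h | ⟨x, hx, hxJ⟩
      · simp [h]
      · have hlen : m + ((k : ℝ) + 1) / N - (m + k / N) = (N : ℝ)⁻¹ := by
          field_simp
          ring
        calc μ ({x | invSqPotential μ x ≤ n} ∩ J k) ≤ μ (J k) := measure_mono inter_subset_right
          _ ≤ ENNReal.ofReal (((N : ℝ)⁻¹) ^ 2) * invSqPotential μ x := by
            simpa only [hlen] using measure_Ico_le_mul_invSqPotential μ hxJ
          _ ≤ ENNReal.ofReal (((N : ℝ)⁻¹) ^ 2) * n := by gcongr; exact hx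
          _ = _ := by rw [ENNReal.ofReal_mul (by positivity), ENNReal.ofReal_natCast]
    calc μ ({x | invSqPotential μ x ≤ n} ∩ Ico m (m + 1))
        ≤ ∑ k ∈ Finset.range N, μ ({x | invSqPotential μ x ≤ n} ∩ J k) :=
          (measure_mono hcover).trans (measure_biUnion_finset_le _ _)
      _ ≤ ∑ k ∈ Finset.range N, ENNReal.ofReal (((N : ℝ)⁻¹) ^ 2 * n) :=
          Finset.sum_le_sum fun k _ ↦ hJ k
      _ = ENNReal.ofReal (n * (N : ℝ)⁻¹) := by
          rw [Finset.sum_const, Finset.card_range, nsmul_eq_mul, ← ENNReal.ofReal_natCast,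
            ← ENNReal.ofReal_mul hN'.le]
          congr 1
          field_simp
  refine le_antisymm (ge_of_tendsto (x := atTop) (f := fun N : ℕ ↦
    ENNReal.ofReal (n * (N : ℝ)⁻¹)) ?_ ?_) zero_le
  · have h : Tendsto (fun N : ℕ ↦ (n : ℝ) * (N : ℝ)⁻¹) atTop (nhds 0) := by
      simpa using (tendsto_inv_atTop_nhds_zero_nat (𝕜 := ℝ)).const_mul (n : ℝ)
    simpa using ENNReal.tendsto_ofReal h
  · filter_upwards [eventually_gt_atTop 0] with N hN using hbound N hN

/-- Almost every point has infinite potential. -/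
theorem ae_invSqPotential_eq_top (μ : Measure ℝ) : ∀ᵐ x ∂μ, invSqPotential μ x = ∞ := by
  have h : μ (⋃ (n : ℕ) (m : ℤ), {x | invSqPotential μ x ≤ n} ∩ Ico (m : ℝ) (m + 1)) = 0 :=
    measure_iUnion_null fun n ↦ measure_iUnion_null fun m ↦
      measure_invSqPotential_le_inter_Ico μ n m
  refine measure_mono_null (fun x (hx : invSqPotential μ x ≠ ∞) ↦ ?_) h
  obtain ⟨n, hn⟩ := ENNReal.exists_nat_gt hx
  exact mem_iUnion₂.2 ⟨n, ⌊x⌋, hn.le, Int.floor_le x, Int.lt_floor_add_one x⟩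

/-- If the potential is infinite at only countably many points of an open interval, then some
nonempty open subinterval is null. -/
theorem exists_Ioo_measure_eq_zero {μ : Measure ℝ} {a b : ℝ} (hab : a < b)
    (hcnt : {x | x ∈ Ioo a b ∧ invSqPotential μ x = ∞}.Countable) :
    ∃ c d : ℝ, c < d ∧ Ioo c d ⊆ Ioo a b ∧ μ (Ioo c d) = 0 := by
  by_contra! hpos
  let V : ℕ → Set ℝ := fun n ↦ {x | invSqPotential μ x ≤ n}ᶜ ∪ (Icc a b)ᶜ
  have hVopen : ∀ n, IsOpen (V n) := fun n ↦
    (isClosed_setOf_invSqPotential_le μ n).isOpen_compl.union isClosed_Icc.isOpen_compl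
  have hVdense : ∀ n, Dense (V n) := by
    intro n
    change Dense ({x | invSqPotential μ x ≤ n}ᶜ ∪ (Icc a b)ᶜ)
    rw [← compl_inter, ← interior_eq_empty_iff_dense_compl, ← not_nonempty_iff_eq_empty,
      interior_inter, interior_Icc]
    rintro ⟨x, hx⟩
    obtain ⟨c, d, hxcd, hcd⟩ := mem_nhds_iff_exists_Ioo_subset.1
      ((isOpen_interior.inter isOpen_Ioo).mem_nhds hx)
    refine hpos c d (hxcd.1.trans hxcd.2) (hcd.trans inter_subset_right) ?_
    refine measure_mono_null (fun y hy ↦ ?_) (ae_invSqPotential_eq_top μ)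
    have hyn : y ∈ {x | invSqPotential μ x ≤ n} := interior_subset (hcd hy).1
    exact (lt_of_le_of_lt hyn (ENNReal.natCast_lt_top n)).ne
  have hres : ∀ᶠ x in residual ℝ, (∀ n, x ∈ V n) ∧
      ∀ y ∈ {x | x ∈ Ioo a b ∧ invSqPotential μ x = ∞}, x ∈ ({y} : Set ℝ)ᶜ := by
    refine (eventually_countable_forall.2 fun n ↦
      residual_of_dense_open (hVopen n) (hVdense n)).and
      ((eventually_countable_ball hcnt).2 fun y _ ↦
        residual_of_dense_open isOpen_compl_singleton (dense_compl_singleton y))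
  obtain ⟨x, hxab, hxV, hxE⟩ := (dense_of_mem_residual hres).inter_open_nonempty _ isOpen_Ioo
    (nonempty_Ioo.2 hab)
  refine hxE x ⟨hxab, ?_⟩ rfl
  by_contra h
  obtain ⟨n, hn⟩ := ENNReal.exists_nat_gt h
  rcases hxV n with h' | h'
  · exact h' hn.le
  · exact h' (Ioo_subset_Icc_self hxab)

/-- let `μ` be a Borel measure on `ℝ`, finite on bounded Borel sets, with
`∫ (1+t²)⁻¹ dμ < ∞` and `μ(ℝ) = ∞`. Let `I = (μ₁, μ₂)` be a nonempty open interval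
such that the set of `λ ∈ I` with `μ({λ}) > 0` or `∫ (t − λ)⁻² dμ(t) = ∞` is at most
countable. If `S` is the topological support of `μ`, then `S ∩ I` is nowhere dense in
`I` and `S ∩ I` equals the intersection with `I` of the closure of the set of atoms of
`μ` lying in `I`. -/
theorem stmt8 (μ : Measure ℝ)
    (hfin : ∀ s : Set ℝ, Bornology.IsBounded s → MeasurableSet s → μ s < ∞)
    (hint : (∫⁻ t, ENNReal.ofReal ((1 + t ^ 2)⁻¹) ∂μ) < ∞)
    (htotal : μ Set.univ = ∞)
    (μ₁ μ₂ : EReal) (hμ : μ₁ < μ₂)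
    (I : Set ℝ) (hIdef : I = {x : ℝ | μ₁ < (x : EReal) ∧ (x : EReal) < μ₂})
    (hcnt : Set.Countable {lam : ℝ | lam ∈ I ∧
      (0 < μ {lam} ∨ (∫⁻ t, (ENNReal.ofReal ((t - lam) ^ 2))⁻¹ ∂μ) = ∞)})
    (S : Set ℝ)
    (hSdef : S = {x : ℝ | ∀ U : Set ℝ, IsOpen U → x ∈ U → 0 < μ U}) :
    NowhereDenseIn (S ∩ I) I ∧
    S ∩ I = closure {lam : ℝ | lam ∈ I ∧ 0 < μ {lam}} ∩ I := by
  have hIopen : IsOpen I := by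
    rw [hIdef]
    exact isOpen_Ioo.preimage continuous_coe_real_ereal
  have hE : {x | x ∈ I ∧ invSqPotential μ x = ∞}.Countable := by
    refine hcnt.mono ?_
    exact fun x hx ↦ ⟨hx.1, Or.inr hx.2⟩
  subst hSdef
  refine ⟨fun a b hab habI ↦ ?_, subset_antisymm ?_ ?_⟩
  · have hc : {x | x ∈ Ioo a b ∧ invSqPotential μ x = ∞}.Countable := by
      refine hE.mono ?_
      exact fun x hx ↦ ⟨habI hx.1, hx.2⟩
    obtain ⟨c, d, hcd, hsub, hnull⟩ := exists_Ioo_measure_eq_zero hab hc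
    refine ⟨c, d, hcd, hsub, eq_empty_of_forall_notMem ?_⟩
    rintro x ⟨⟨hxS, -⟩, hx⟩
    exact (hxS _ isOpen_Ioo hx).ne' hnull
  · rintro x ⟨hxS, hxI⟩
    refine ⟨mem_closure_iff.2 fun U hU hxU ↦ ?_, hxI⟩
    by_contra hno
    refine (hxS (U ∩ I) (hU.inter hIopen) ⟨hxU, hxI⟩).ne' ?_
    have hnull : μ {y | y ∈ U ∩ I ∧ invSqPotential μ y = ∞} = 0 := by
      have hc : {y | y ∈ U ∩ I ∧ invSqPotential μ y = ∞}.Countable := by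
        refine hE.mono ?_
        exact fun y hy ↦ ⟨hy.1.2, hy.2⟩
      rw [← biUnion_of_singleton {y | y ∈ U ∩ I ∧ invSqPotential μ y = ∞},
        measure_biUnion_null_iff hc]
      intro y hy
      by_contra hy0
      exact hno ⟨y, hy.1.1, hy.1.2, pos_iff_ne_zero.2 hy0⟩
    refine measure_mono_null (fun y hy ↦ ?_) (measure_union_null hnull
      (ae_invSqPotential_eq_top μ))
    by_cases h : invSqPotential μ y = ∞
    · exact Or.inl ⟨hy, h⟩
    · exact Or.inr h
  · rintro x ⟨hx, hxI⟩
    refine ⟨fun U hU hxU ↦ ?_, hxI⟩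
    obtain ⟨y, hyU, -, hy⟩ := mem_closure_iff.1 hx U hU hxU
    exact hy.trans_le (measure_mono (singleton_subset_iff.2 hyU))
end

section
/- For every nonempty open interval I = (μ₁, μ₂) of ℝ (with −∞ ≤ μ₁ < μ₂ ≤ ∞) there exist a countably infinite set Y₁ ⊆ I, an infinite set Y₂ ⊆ I, and a Borel measure F on ℝ, finite on bounded Borel sets, such that: (1) every point of Y₁ is an isolated point of Y₁; (2) Y₂ is exactly the set of accumulation points of Y₁ that lie in I; (3) F(I ∖ Y₁) = 0 and F({y}) > 0 for every y ∈ Y₁; (4) F(ℝ) = ∞; (5) ∫_ℝ (1 + t²)^{-1} dF(t) < ∞; and (6) for every λ ∈ I with F({λ}) = 0 one has ∫_ℝ (t − λ)^{-2} dF(t) < ∞ (in particular this holds for every λ ∈ Y₂). -/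
open Set Filter MeasureTheory
open scoped ENNReal

/-- The point `m + 1 + 1 / (k + 2)` has distance at least `1 / ((k + 2) * (k + 3))` from every
other point of this form. -/
lemma eq_of_abs_sub_lt (m k m' k' : ℕ)
    (h : |((m' : ℝ) + 1 + 1 / (k' + 2)) - (m + 1 + 1 / (k + 2))| < 1 / ((k + 2) * (k + 3))) :
    m' = m ∧ k' = k := by
  obtain ⟨h1, h2⟩ := abs_lt.1 h
  have half : ∀ j : ℕ, (1 : ℝ) / (j + 2) ≤ 1 / 2 := fun j =>
    one_div_le_one_div_of_le (by norm_num) (by linarith [j.cast_nonneg (α := ℝ)])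
  have pos : ∀ j : ℕ, (0 : ℝ) < 1 / (j + 2) := fun j => by positivity
  have hρ : (1 : ℝ) / ((k + 2) * (k + 3)) ≤ 1 / 6 :=
    one_div_le_one_div_of_le (by norm_num) (by nlinarith [k.cast_nonneg (α := ℝ)])
  have hm : m' = m := by
    rcases lt_trichotomy m' m with h | h | h
    · have : (m' : ℝ) + 1 ≤ m := by exact_mod_cast h
      linarith [half k, half k', pos k, pos k']
    · exact h
    · have : (m : ℝ) + 1 ≤ m' := by exact_mod_cast h
      linarith [half k, half k', pos k, pos k']
  refine ⟨hm, ?_⟩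
  subst hm
  have gap : (1 : ℝ) / (k + 2) - 1 / (k + 3) = 1 / ((k + 2) * (k + 3)) := by
    field_simp; ring
  rcases lt_trichotomy k' k with h | h | h
  · have hk : (k' : ℝ) + 2 ≤ k + 1 := by
      have : (k' : ℝ) + 1 ≤ k := by exact_mod_cast h
      linarith
    have h3 := one_div_le_one_div_of_le (by positivity) hk
    have h4 : (1 : ℝ) / (k + 1) - 1 / (k + 2) = 1 / ((k + 1) * (k + 2)) := by
      field_simp; ring
    have h5 : (1 : ℝ) / ((k + 2) * (k + 3)) ≤ 1 / ((k + 1) * (k + 2)) :=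
      one_div_le_one_div_of_le (by positivity) (by nlinarith [k.cast_nonneg (α := ℝ)])
    linarith
  · exact h
  · have hk : (k : ℝ) + 3 ≤ k' + 2 := by
      have : (k : ℝ) + 1 ≤ k' := by exact_mod_cast h
      linarith
    have h3 := one_div_le_one_div_of_le (by positivity) hk
    linarith

/-- A double sequence in `(c, d)` whose `m`-th row converges to
`c + (d - c) / (m + 1)`. -/
noncomputable def clusterSeq (c d : ℝ) (i : ℕ × ℕ) : ℝ :=
  c + (d - c) / ((i.1 : ℝ) + 1 + 1 / (i.2 + 2))

lemma lt_clusterSeq {c d : ℝ} (h : c < d) (i : ℕ × ℕ) : c < clusterSeq c d i := by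
  have : 0 < (d - c) / ((i.1 : ℝ) + 1 + 1 / (i.2 + 2)) :=
    div_pos (sub_pos.2 h) (by positivity)
  unfold clusterSeq; linarith

lemma clusterSeq_lt {c d : ℝ} (h : c < d) (i : ℕ × ℕ) : clusterSeq c d i < d := by
  have : (d - c) / ((i.1 : ℝ) + 1 + 1 / (i.2 + 2)) < d - c := by
    apply div_lt_self (sub_pos.2 h)
    have : (0 : ℝ) < 1 / (i.2 + 2) := by positivity
    linarith [(i.1).cast_nonneg (α := ℝ)]
  unfold clusterSeq; linarith

lemma exists_clusterSeq_isolated {c d : ℝ} (h : c < d) (i : ℕ × ℕ) :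
    ∃ r : ℝ, 0 < r ∧ r ≤ 1 ∧
      ∀ j, |clusterSeq c d j - clusterSeq c d i| < r → j = i := by
  have key : ∀ j, (d - c) / (clusterSeq c d j - c) = (j.1 : ℝ) + 1 + 1 / (j.2 + 2) := by
    intro j
    have h0 : d - c ≠ 0 := (sub_pos.2 h).ne'
    have h1 : ((j.1 : ℝ) + 1 + 1 / (j.2 + 2)) ≠ 0 := by positivity
    unfold clusterSeq
    rw [add_sub_cancel_left, div_div_cancel₀ h0]
  have hc : ContinuousAt (fun x => (d - c) / (x - c)) (clusterSeq c d i) :=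
    ContinuousAt.div continuousAt_const (by fun_prop) (sub_pos.2 (lt_clusterSeq h i)).ne'
  obtain ⟨r, hr, H⟩ := Metric.continuousAt_iff.1 hc
    (1 / (((i.2 : ℝ) + 2) * (i.2 + 3))) (by positivity)
  refine ⟨min r 1, lt_min hr one_pos, min_le_right _ _, fun j hj => ?_⟩
  have h1 := H (x := clusterSeq c d j) (by
    rw [Real.dist_eq]; exact hj.trans_le (min_le_left _ _))
  rw [Real.dist_eq, key, key] at h1
  exact Prod.ext_iff.2 (eq_of_abs_sub_lt _ _ _ _ h1)

lemma tendsto_clusterSeq (c d : ℝ) (m : ℕ) :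
    Tendsto (fun k : ℕ => clusterSeq c d (m, k)) atTop (nhds (c + (d - c) / (m + 1))) := by
  have h1 : Tendsto (fun k : ℕ => (1 : ℝ) / ((k : ℝ) + 2)) atTop (nhds 0) := by
    have := (tendsto_one_div_add_atTop_nhds_zero_nat (𝕜 := ℝ)).comp (tendsto_add_atTop_nat 1)
    refine this.congr fun k => ?_
    simp only [Function.comp, Nat.cast_add, Nat.cast_one]
    ring_nf
  have h2 : Tendsto (fun k : ℕ => (m : ℝ) + 1 + 1 / ((k : ℝ) + 2)) atTop
      (nhds ((m : ℝ) + 1)) := by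
    simpa using h1.const_add ((m : ℝ) + 1)
  exact ((tendsto_const_nhds (x := d - c)).div h2 (by positivity)).const_add c

lemma clusterSeq_lt_limit {c d : ℝ} (h : c < d) (m k : ℕ) :
    clusterSeq c d (m, k) < c + (d - c) / (m + 1) := by
  have : (d - c) / ((m : ℝ) + 1 + 1 / (k + 2)) < (d - c) / (m + 1) := by
    apply div_lt_div_of_pos_left (sub_pos.2 h) (by positivity)
    have : (0 : ℝ) < 1 / (k + 2) := by positivity
    linarith
  simpa [clusterSeq] using this

/-- The purely atomic measure with mass `w i` at `p i`. -/
noncomputable def atomic {ι : Type*} (p : ι → ℝ) (w : ι → ℝ≥0∞) : Measure ℝ :=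
  Measure.sum fun i => w i • Measure.dirac (p i)

lemma lintegral_atomic {ι : Type*} (p : ι → ℝ) (w : ι → ℝ≥0∞) (f : ℝ → ℝ≥0∞) :
    ∫⁻ t, f t ∂(atomic p w) = ∑' i, w i * f (p i) := by
  simp [atomic, lintegral_sum_measure]

lemma le_atomic_singleton {ι : Type*} (p : ι → ℝ) (w : ι → ℝ≥0∞) (i : ι) :
    w i ≤ atomic p w {p i} := by
  rw [atomic, Measure.sum_apply _ (measurableSet_singleton _)]
  refine le_trans ?_ (ENNReal.le_tsum i)
  simp

lemma atomic_eq_zero {ι : Type*} (p : ι → ℝ) (w : ι → ℝ≥0∞) {s : Set ℝ}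
    (hs : MeasurableSet s) (h : ∀ i, p i ∉ s) : atomic p w s = 0 := by
  rw [atomic, Measure.sum_apply _ hs]
  simp [h]

/-- A measure integrating `(1 + t²)⁻¹` is finite on bounded sets. -/
lemma measure_lt_top_of_isBounded {F : Measure ℝ}
    (hF : ∫⁻ t, ENNReal.ofReal ((1 + t ^ 2)⁻¹) ∂F < ∞) {s : Set ℝ}
    (hs : Bornology.IsBounded s) : F s < ∞ := by
  obtain ⟨R, hR⟩ := hs.exists_norm_le
  have hε : ENNReal.ofReal ((1 + R ^ 2)⁻¹) ≠ 0 := by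
    simp only [ne_eq, ENNReal.ofReal_eq_zero, not_le]; positivity
  have hm : Measurable fun t : ℝ => ENNReal.ofReal ((1 + t ^ 2)⁻¹) := by fun_prop
  refine lt_of_le_of_lt (measure_mono fun t ht => ?_)
    ((meas_ge_le_lintegral_div hm.aemeasurable hε ENNReal.ofReal_ne_top).trans_lt
      (ENNReal.div_lt_top hF.ne hε))
  apply ENNReal.ofReal_le_ofReal
  apply inv_anti₀ (by positivity)
  have := sq_le_sq' (neg_le_of_abs_le (hR t ht)) (le_of_abs_le (hR t ht))
  linarith

lemma inv_ofReal_sq_sub_le {l t δ : ℝ} (hδ : 0 < δ) (h : δ ≤ |t - l|) :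
    (ENNReal.ofReal ((t - l) ^ 2))⁻¹ ≤
      ENNReal.ofReal (2 + (1 + 2 * l ^ 2) / δ ^ 2) * ENNReal.ofReal ((1 + t ^ 2)⁻¹) := by
  have h2 : δ ^ 2 ≤ (t - l) ^ 2 := by
    rw [← sq_abs (t - l)]; exact pow_le_pow_left₀ hδ.le h 2
  have hpos : 0 < (t - l) ^ 2 := lt_of_lt_of_le (by positivity) h2
  rw [← ENNReal.ofReal_inv_of_pos hpos, ← ENNReal.ofReal_mul (by positivity)]
  apply ENNReal.ofReal_le_ofReal
  rw [← div_eq_mul_inv, inv_le_comm₀ hpos (by positivity), inv_div,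
    div_le_iff₀ (by positivity)]
  have h3 : (1 + 2 * l ^ 2) ≤ (t - l) ^ 2 * ((1 + 2 * l ^ 2) / δ ^ 2) := by
    rw [mul_div_assoc', le_div_iff₀ (by positivity)]
    nlinarith [sq_nonneg l]
  nlinarith [sq_nonneg (t - 2 * l)]

/-- If the atoms `p i` are isolated with radii `r i`, the weights `ε i * r i ^ 2 / 4` make
`(t - l)⁻²` integrable for every `l` that is not an atom. -/
lemma lintegral_atomic_isolated_lt_top {ι : Type*} {p r : ι → ℝ} {ε : ι → ℝ≥0∞}
    (hr : ∀ i, 0 < r i) (hp : ∀ i j, |p j - p i| < r i → j = i)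
    (hε : ∑' i, ε i ≠ ∞) {l : ℝ} (hl : ∀ i, p i ≠ l) :
    ∫⁻ t, (ENNReal.ofReal ((t - l) ^ 2))⁻¹
      ∂(atomic p fun i => ε i * ENNReal.ofReal ((r i / 2) ^ 2)) < ∞ := by
  rw [lintegral_atomic]
  obtain ⟨C, hC⟩ : ∃ C : ℝ, ∀ i, (r i / 2) ^ 2 / (p i - l) ^ 2 ≤ C := by
    have hpos : ∀ i, 0 < (p i - l) ^ 2 := fun i => by
      have := sub_ne_zero.2 (hl i)
      positivity
    by_cases h : ∃ i, |p i - l| < r i / 2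
    · obtain ⟨i, hi⟩ := h
      refine ⟨max 1 ((r i / 2) ^ 2 / (p i - l) ^ 2), fun j => ?_⟩
      by_cases hj : |p j - l| < r j / 2
      · have : j = i := by
          have h1 : |p j - p i| ≤ |p j - l| + |p i - l| := by
            simpa [abs_sub_comm l (p i)] using abs_sub_le (p j) l (p i)
          rcases le_total (r i) (r j) with h | h
          · refine (hp j i ?_).symm
            rw [abs_sub_comm]; linarith
          · exact hp i j (by linarith)
        subst this
        exact le_max_right _ _
      · refine le_max_of_le_left ?_
        rw [div_le_one (hpos j), ← sq_abs (p j - l)]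
        exact pow_le_pow_left₀ (half_pos (hr j)).le (not_lt.1 hj) 2
    · push Not at h
      refine ⟨1, fun j => ?_⟩
      rw [div_le_one (hpos j), ← sq_abs (p j - l)]
      exact pow_le_pow_left₀ (half_pos (hr j)).le (h j) 2
  calc ∑' i, ε i * ENNReal.ofReal ((r i / 2) ^ 2) * (ENNReal.ofReal ((p i - l) ^ 2))⁻¹
      ≤ ∑' i, ε i * ENNReal.ofReal C := by
        refine ENNReal.tsum_le_tsum fun i => ?_
        rw [mul_assoc]
        gcongr
        have hpos : 0 < (p i - l) ^ 2 := by
          have := sub_ne_zero.2 (hl i)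
          positivity
        rw [← ENNReal.ofReal_inv_of_pos hpos, ← ENNReal.ofReal_mul (by positivity),
          ← div_eq_mul_inv]
        exact ENNReal.ofReal_le_ofReal (hC i)
    _ = (∑' i, ε i) * ENNReal.ofReal C := ENNReal.tsum_mul_right
    _ < ∞ := ENNReal.mul_lt_top hε.lt_top ENNReal.ofReal_lt_top

/-- Unit masses at `c - 1, c - 2, …`. -/
noncomputable def unitTail (c : ℝ) : Measure ℝ := atomic (fun n : ℕ => c - (n + 1)) fun _ => 1

lemma lintegral_unitTail_lt_top (c : ℝ) :
    ∫⁻ t, ENNReal.ofReal ((1 + t ^ 2)⁻¹) ∂(unitTail c) < ∞ := by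
  rw [unitTail, lintegral_atomic]
  have hs : Summable fun n : ℕ => (2 * c ^ 2 + 2) * ((1 : ℝ) / ((n : ℝ) + 1) ^ 2) := by
    apply Summable.mul_left
    have := (summable_nat_add_iff 1).2 (Real.summable_one_div_nat_pow.2 one_lt_two)
    simpa using this
  refine lt_of_le_of_lt (ENNReal.tsum_le_tsum fun n => ?_) hs.tsum_ofReal_lt_top
  rw [one_mul]
  apply ENNReal.ofReal_le_ofReal
  rw [mul_one_div, inv_le_comm₀ (by positivity) (by positivity), inv_div,
    div_le_iff₀ (by positivity)]
  have h1 : ((n : ℝ) + 1) ^ 2 ≤ 2 * c ^ 2 + 2 * (c - (n + 1)) ^ 2 := by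
    nlinarith [sq_nonneg (c - 2 * (c - (n + 1) : ℝ) - c), sq_nonneg (c + (c - (n + 1) : ℝ))]
  nlinarith [mul_nonneg (sq_nonneg c) (sq_nonneg (c - (n + 1) : ℝ))]

lemma exists_pos_le_abs_sub {c l : ℝ} (hl : ∀ n : ℕ, c - (n + 1) ≠ l) :
    ∃ δ > 0, ∀ n : ℕ, δ ≤ |c - (n + 1) - l| := by
  by_cases h : ∃ n : ℕ, |c - (n + 1) - l| < 1 / 2
  · obtain ⟨n, hn⟩ := h
    refine ⟨|c - (n + 1) - l|, abs_pos.2 (sub_ne_zero.2 (hl n)), fun m => ?_⟩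
    by_cases hm : m = n
    · rw [hm]
    · have h1 : (1 : ℝ) ≤ |(m : ℝ) - n| := by
        have : (1 : ℤ) ≤ |(m : ℤ) - n| := Int.one_le_abs (by omega)
        exact_mod_cast this
      have h2 : |(m : ℝ) - n| ≤ |c - (m + 1) - l| + |c - (n + 1) - l| := by
        rw [abs_sub_comm (m : ℝ)]
        calc |(n : ℝ) - m| = |(c - (m + 1) - l) - (c - (n + 1) - l)| := by ring_nf
          _ ≤ _ := abs_sub _ _
      linarith
  · push Not at h
    exact ⟨1 / 2, by norm_num, h⟩

lemma lintegral_unitTail_sq_sub_lt_top {c l : ℝ} (hl : ∀ n : ℕ, c - (n + 1) ≠ l) :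
    ∫⁻ t, (ENNReal.ofReal ((t - l) ^ 2))⁻¹ ∂(unitTail c) < ∞ := by
  obtain ⟨δ, hδ, H⟩ := exists_pos_le_abs_sub hl
  have h5 := lintegral_unitTail_lt_top c
  rw [unitTail, lintegral_atomic] at h5 ⊢
  simp only [one_mul] at h5 ⊢
  refine lt_of_le_of_lt (ENNReal.tsum_le_tsum fun n => inv_ofReal_sq_sub_le hδ (H n)) ?_
  rw [ENNReal.tsum_mul_left]
  exact ENNReal.mul_lt_top ENNReal.ofReal_lt_top h5

/-- for every nonempty open interval `I = (μ₁, μ₂)` there exist a countably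
infinite set `Y₁ ⊆ I`, an infinite set `Y₂ ⊆ I` and a Borel measure `F` on `ℝ`, finite
on bounded Borel sets, such that: (1) every point of `Y₁` is isolated in `Y₁`;
(2) `Y₂` is exactly the set of accumulation points of `Y₁` lying in `I`;
(3) `F(I ∖ Y₁) = 0` and every point of `Y₁` is an atom of `F`; (4) `F(ℝ) = ∞`;
(5) `∫ (1+t²)⁻¹ dF < ∞`; (6) `∫ (t − λ)⁻² dF(t) < ∞` for every `λ ∈ I` with
`F({λ}) = 0`. -/
theorem stmt9 (μ₁ μ₂ : EReal) (hμ : μ₁ < μ₂)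
    (I : Set ℝ) (hIdef : I = {x : ℝ | μ₁ < (x : EReal) ∧ (x : EReal) < μ₂}) :
    ∃ (Y₁ Y₂ : Set ℝ) (F : Measure ℝ),
      Y₁ ⊆ I ∧ Y₁.Countable ∧ Y₁.Infinite ∧
      Y₂ ⊆ I ∧ Y₂.Infinite ∧
      (∀ s : Set ℝ, Bornology.IsBounded s → MeasurableSet s → F s < ∞) ∧
      (∀ y ∈ Y₁, ∃ U : Set ℝ, IsOpen U ∧ y ∈ U ∧ U ∩ Y₁ = {y}) ∧
      Y₂ = {x : ℝ | x ∈ I ∧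
        ∀ U : Set ℝ, IsOpen U → x ∈ U → ∃ y ∈ Y₁, y ≠ x ∧ y ∈ U} ∧
      F (I \ Y₁) = 0 ∧ (∀ y ∈ Y₁, 0 < F {y}) ∧
      F Set.univ = ∞ ∧
      (∫⁻ t, ENNReal.ofReal ((1 + t ^ 2)⁻¹) ∂F) < ∞ ∧
      (∀ lam ∈ I, F {lam} = 0 →
        (∫⁻ t, (ENNReal.ofReal ((t - lam) ^ 2))⁻¹ ∂F) < ∞) := by
  obtain ⟨c, hc1, hc2⟩ := EReal.lt_iff_exists_real_btwn.1 hμ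
  obtain ⟨d, hd1, hd2⟩ := EReal.lt_iff_exists_real_btwn.1 hc2
  have hcd : c < d := EReal.coe_lt_coe_iff.1 hd1
  have hIcc : ∀ x, c ≤ x → x ≤ d → x ∈ I := fun x h1 h2 => by
    rw [hIdef]
    exact ⟨hc1.trans_le (EReal.coe_le_coe_iff.2 h1), (EReal.coe_le_coe_iff.2 h2).trans_lt hd2⟩
  set p := clusterSeq c d with hpdef
  choose r hr hr1 hp using exists_clusterSeq_isolated hcd
  have hpI : ∀ i, p i ∈ I := fun i =>
    hIcc _ (lt_clusterSeq hcd i).le (clusterSeq_lt hcd i).le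
  obtain ⟨ε, hε0, hε⟩ := ENNReal.exists_pos_sum_of_countable' one_ne_zero (ℕ × ℕ)
  have hεtop : ∑' i, ε i ≠ ∞ := (hε.trans ENNReal.one_lt_top).ne
  set w : ℕ × ℕ → ℝ≥0∞ := fun i => ε i * ENNReal.ofReal ((r i / 2) ^ 2) with hw
  set z : ℕ → ℝ := fun n => c - (n + 1) with hz
  have hzc : ∀ n, z n < c := fun n => by
    simp only [hz]; linarith [n.cast_nonneg (α := ℝ)]
  have hw0 : ∀ i, 0 < w i := fun i =>
    ENNReal.mul_pos (hε0 i).ne' (by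
      have := hr i
      simp only [ne_eq, ENNReal.ofReal_eq_zero, not_le]; positivity)
  have hpinj : Function.Injective p := fun i j hij => hp j i (by
    rw [← hpdef, hij, sub_self, abs_zero]; exact hr j)
  set T : Set ℝ := range p ∪ range z with hT
  have hTc : T.Countable := (countable_range p).union (countable_range z)
  set F : Measure ℝ := atomic p w + unitTail c with hF
  have hFp : ∀ i, 0 < F {p i} := fun i => by
    rw [hF, Measure.add_apply]
    exact (hw0 i).trans_le ((le_atomic_singleton p w i).trans le_self_add)
  have hFz : ∀ n, 0 < F {z n} := fun n => by
    rw [hF, Measure.add_apply]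
    exact zero_lt_one.trans_le ((le_atomic_singleton z (fun _ => 1) n).trans le_add_self)
  have h5 : (∫⁻ t, ENNReal.ofReal ((1 + t ^ 2)⁻¹) ∂F) < ∞ := by
    rw [hF, lintegral_add_measure]
    refine ENNReal.add_lt_top.2 ⟨?_, lintegral_unitTail_lt_top c⟩
    rw [lintegral_atomic]
    refine lt_of_le_of_lt (ENNReal.tsum_le_tsum fun i => ?_) hεtop.lt_top
    have h1 : ENNReal.ofReal ((r i / 2) ^ 2) ≤ 1 := by
      rw [ENNReal.ofReal_le_one]
      nlinarith [hr i, hr1 i]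
    have h2 : ENNReal.ofReal ((1 + p i ^ 2)⁻¹) ≤ 1 := by
      rw [ENNReal.ofReal_le_one]
      exact inv_le_one_of_one_le₀ (by nlinarith [sq_nonneg (p i)])
    calc w i * ENNReal.ofReal ((1 + p i ^ 2)⁻¹) ≤ ε i * 1 * 1 := by
          simp only [hw]; gcongr
      _ = ε i := by simp
  refine ⟨T ∩ I, {x : ℝ | x ∈ I ∧
        ∀ U : Set ℝ, IsOpen U → x ∈ U → ∃ y ∈ T ∩ I, y ≠ x ∧ y ∈ U}, F,
    inter_subset_right, hTc.mono inter_subset_left, ?_, fun x hx => hx.1, ?_,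
    fun s hs _ => measure_lt_top_of_isBounded h5 hs, ?_, rfl, ?_, ?_, ?_, h5, ?_⟩
  · refine (infinite_range_of_injective hpinj).mono ?_
    rintro _ ⟨i, rfl⟩
    exact ⟨Or.inl ⟨i, rfl⟩, hpI i⟩
  · refine (infinite_range_of_injective (f := fun m : ℕ => c + (d - c) / ((m : ℝ) + 1))
      fun m n hmn => ?_).mono ?_
    · have h0 : d - c ≠ 0 := (sub_pos.2 hcd).ne'
      have h1 : (d - c) / ((m : ℝ) + 1) = (d - c) / ((n : ℝ) + 1) := by simpa using hmn
      have h2 : (m : ℝ) + 1 = n + 1 := by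
        rw [div_eq_div_iff (by positivity) (by positivity)] at h1
        exact (mul_left_cancel₀ h0 h1).symm
      exact_mod_cast add_right_cancel h2
    · rintro _ ⟨m, rfl⟩
      have hpos : 0 < (d - c) / ((m : ℝ) + 1) := div_pos (sub_pos.2 hcd) (by positivity)
      have hle : (d - c) / ((m : ℝ) + 1) ≤ d - c :=
        div_le_self (sub_pos.2 hcd).le (by linarith [m.cast_nonneg (α := ℝ)])
      refine ⟨hIcc _ (by linarith) (by linarith), fun U hU hx => ?_⟩
      obtain ⟨k, hk⟩ := ((tendsto_clusterSeq c d m).eventually (hU.mem_nhds hx)).exists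
      exact ⟨p (m, k), ⟨Or.inl ⟨_, rfl⟩, hpI _⟩, (clusterSeq_lt_limit hcd m k).ne, hk⟩
  · rintro y ⟨⟨i, rfl⟩ | ⟨n, rfl⟩, hy⟩
    · refine ⟨Metric.ball (p i) (r i) ∩ Ioi c, Metric.isOpen_ball.inter isOpen_Ioi,
        ⟨Metric.mem_ball_self (hr i), lt_clusterSeq hcd i⟩, ?_⟩
      refine Subset.antisymm ?_ ?_
      · rintro x ⟨⟨hx1, hx2⟩, ⟨j, rfl⟩ | ⟨n, rfl⟩, -⟩
        · rw [Metric.mem_ball, Real.dist_eq] at hx1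
          rw [hp i j hx1, mem_singleton_iff]
        · exact absurd (hzc n) (not_lt.2 (le_of_lt hx2))
      · rintro _ rfl
        exact ⟨⟨Metric.mem_ball_self (hr i), lt_clusterSeq hcd i⟩, Or.inl ⟨i, rfl⟩, hy⟩
    · refine ⟨Metric.ball (z n) 1 ∩ Iio c, Metric.isOpen_ball.inter isOpen_Iio,
        ⟨Metric.mem_ball_self one_pos, hzc n⟩, ?_⟩
      refine Subset.antisymm ?_ ?_
      · rintro x ⟨⟨hx1, hx2⟩, ⟨j, rfl⟩ | ⟨m, rfl⟩, -⟩
        · exact absurd (lt_clusterSeq hcd j) (not_lt.2 (le_of_lt hx2))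
        · rw [Metric.mem_ball, Real.dist_eq] at hx1
          have h1 : |(n : ℝ) - m| < 1 := by
            convert hx1 using 2
            simp only [hz]; ring
          have h2 : |(n : ℤ) - m| < 1 := by exact_mod_cast h1
          have h3 : m = n := by
            have := Int.abs_lt_one_iff.1 h2
            omega
          rw [h3, mem_singleton_iff]
      · rintro _ rfl
        exact ⟨⟨Metric.mem_ball_self one_pos, hzc n⟩, Or.inr ⟨n, rfl⟩, hy⟩
  · refine measure_mono_null (t := Tᶜ) (fun x hx hxT => hx.2 ⟨hxT, hx.1⟩) ?_
    have hm : MeasurableSet Tᶜ := hTc.measurableSet.compl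
    rw [hF, Measure.add_apply, unitTail,
      atomic_eq_zero p w hm fun i hi => hi (Or.inl ⟨i, rfl⟩),
      atomic_eq_zero z _ hm fun n hn => hn (Or.inr ⟨n, rfl⟩), add_zero]
  · rintro y ⟨⟨i, rfl⟩ | ⟨n, rfl⟩, -⟩
    · exact hFp i
    · exact hFz n
  · have h1 : unitTail c univ = ∞ := by
      rw [← lintegral_one, unitTail, lintegral_atomic]
      simp
    rw [hF, Measure.add_apply, h1, add_top]
  · intro l _ hl
    rw [hF, lintegral_add_measure]
    refine ENNReal.add_lt_top.2 ⟨?_, ?_⟩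
    · exact lintegral_atomic_isolated_lt_top hr hp hεtop fun i h =>
        (hFp i).ne' ((congrArg (fun x => F {x}) h).trans hl)
    · exact lintegral_unitTail_sq_sub_lt_top fun n h =>
        (hFz n).ne' ((congrArg (fun x => F {x}) h).trans hl)
end

section
/- Let μ₂ ∈ ℝ and −∞ ≤ μ₁ < μ₂, and set I = (μ₁, μ₂). Let (λ_k)_{k≥0} be a strictly increasing sequence in I with lim_{k→∞} λ_k = μ₂, and for each j, k ≥ 1 let λ_{jk} ∈ (λ_{k−1}, λ_k) satisfy λ_{jk} < λ_{j+1,k}, λ_k − λ_{jk} < 1, and lim_{j→∞} λ_{jk} = λ_k. Let u_{jk} > 0 be such that s_k := ∑_{j≥1} u_{jk} < ∞ for each k and ∑_{k≥1} s_k < ∞. Define the Borel measure F = ∑_{k≥1} ∑_{j≥1} u_{jk}(λ_k − λ_{jk})² · δ_{λ_{jk}} + (Lebesgue measure restricted to ℝ ∖ I), where δ_x denotes the Dirac measure at x. Then F(ℝ) = ∞, ∫_ℝ (1 + t²)^{-1} dF(t) < ∞, and ∫_ℝ (t − λ_k)^{-2} dF(t) < ∞ for every k ≥ 1. -/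
open Set Filter MeasureTheory
open scoped ENNReal

/-- A weighted sum of Dirac masses plus Lebesgue measure on a set `S` integrates `g` to a finite
value when the atoms contribute a summable family and `g` has Cauchy decay on `S`. -/
theorem lintegral_sum_dirac_add_restrict_lt_top {S : Set ℝ} (hS : MeasurableSet S)
    (x w u : ℕ → ℕ → ℝ) (hu : ∀ j k, 0 ≤ u j k)
    (husum : ∀ k, Summable fun j => u j k) (hssum : Summable fun k => ∑' j, u j k)
    (g : ℝ → ℝ≥0∞) {C c : ℝ} (hC : 0 ≤ C)
    (hatom : ∀ j k, ENNReal.ofReal (w j k) * g (x j k) ≤ ENNReal.ofReal (C * u j k))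
    (hdecay : ∀ t ∈ S, g t ≤ ENNReal.ofReal (C * (1 + (t - c) ^ 2)⁻¹)) :
    (∫⁻ t, g t ∂((Measure.sum fun k => Measure.sum fun j =>
        ENNReal.ofReal (w j k) • Measure.dirac (x j k)) + volume.restrict S)) < ∞ := by
  rw [lintegral_add_measure, ENNReal.add_lt_top]
  constructor
  · simp only [lintegral_sum_measure, lintegral_smul_measure, lintegral_dirac, smul_eq_mul]
    calc ∑' k, ∑' j, ENNReal.ofReal (w j k) * g (x j k)
        ≤ ∑' k, ∑' j, ENNReal.ofReal (C * u j k) :=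
          ENNReal.tsum_le_tsum fun k => ENNReal.tsum_le_tsum fun j => hatom j k
      _ = ∑' k, ENNReal.ofReal (C * ∑' j, u j k) := by
          refine tsum_congr fun k => ?_
          rw [← ENNReal.ofReal_tsum_of_nonneg (fun j => mul_nonneg hC (hu j k))
            ((husum k).mul_left C), tsum_mul_left]
      _ = ENNReal.ofReal (∑' k, C * ∑' j, u j k) :=
          (ENNReal.ofReal_tsum_of_nonneg
            (fun k => mul_nonneg hC (tsum_nonneg fun j => hu j k)) (hssum.mul_left C)).symm
      _ < ∞ := ENNReal.ofReal_lt_top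
  · calc ∫⁻ t in S, g t
        ≤ ∫⁻ t in S, ENNReal.ofReal (C * (1 + (t - c) ^ 2)⁻¹) :=
          setLIntegral_mono' hS hdecay
      _ ≤ ∫⁻ t, ENNReal.ofReal (C * (1 + (t - c) ^ 2)⁻¹) := setLIntegral_le_lintegral _ _
      _ < ∞ := ((integrable_inv_one_add_sq.comp_sub_right c).const_mul C).lintegral_lt_top

/-- Away from the origin, the inverse square is dominated by a multiple of the Cauchy density. -/
theorem inv_ofReal_sq_le_of_le_abs {d y : ℝ} (hd : 0 < d) (hy : d ≤ |y|) :
    (ENNReal.ofReal (y ^ 2))⁻¹ ≤ ENNReal.ofReal ((1 + (d ^ 2)⁻¹) * (1 + y ^ 2)⁻¹) := by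
  have hsq : d ^ 2 ≤ y ^ 2 := sq_le_sq.2 (by rwa [abs_of_pos hd])
  have hd2 : 0 < d ^ 2 := by positivity
  have hy2 : 0 < y ^ 2 := hd2.trans_le hsq
  rw [← ENNReal.ofReal_inv_of_pos hy2]
  apply ENNReal.ofReal_le_ofReal
  rw [← div_eq_mul_inv, inv_le_iff_one_le_mul₀ hy2, div_mul_eq_mul_div,
    one_le_div (by positivity)]
  have h : 1 ≤ (d ^ 2)⁻¹ * y ^ 2 := by
    rwa [inv_mul_eq_div, one_le_div hd2]
  linarith

/-- let `I = (μ₁, μ₂)` with `μ₂ ∈ ℝ`, let `(λ_k)_{k≥0}` be a strictly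
increasing sequence in `I` tending to `μ₂`, and for `j ≥ 0, k ≥ 0` let
`λ_{j,k+1} ∈ (λ_k, λ_{k+1})` (here `lj j k` denotes `λ_{j+1,k+1}` of the paper) with
`lj j k < lj (j+1) k`, `λ_{k+1} − lj j k < 1` and `lj j k → λ_{k+1}` as `j → ∞`.
Let `u j k > 0` with `s_k = ∑_j u j k < ∞` and `∑_k s_k < ∞`. Define
`F = ∑_{k,j} u j k · (λ_{k+1} − lj j k)² · δ_{lj j k} + Leb|_{ℝ ∖ I}`. Then
`F(ℝ) = ∞`, `∫ (1+t²)⁻¹ dF < ∞`, and `∫ (t − λ_{k+1})⁻² dF < ∞` for every `k`. -/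
theorem stmt10 (μ₁ : EReal) (μ₂ : ℝ) (hμ : μ₁ < (μ₂ : EReal))
    (I : Set ℝ) (hIdef : I = {x : ℝ | μ₁ < (x : EReal) ∧ x < μ₂})
    (l : ℕ → ℝ) (hlI : ∀ k, l k ∈ I) (hlmono : StrictMono l)
    (hllim : Tendsto l atTop (nhds μ₂))
    (lj : ℕ → ℕ → ℝ)
    (hlj : ∀ j k, lj j k ∈ Set.Ioo (l k) (l (k + 1)))
    (hljmono : ∀ j k, lj j k < lj (j + 1) k)
    (hlj1 : ∀ j k, l (k + 1) - lj j k < 1)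
    (hljlim : ∀ k, Tendsto (fun j => lj j k) atTop (nhds (l (k + 1))))
    (u : ℕ → ℕ → ℝ) (hu : ∀ j k, 0 < u j k)
    (husum : ∀ k, Summable fun j => u j k)
    (hssum : Summable fun k => ∑' j, u j k)
    (F : Measure ℝ)
    (hFdef : F = (Measure.sum fun k => Measure.sum fun j =>
        ENNReal.ofReal (u j k * (l (k + 1) - lj j k) ^ 2) • Measure.dirac (lj j k))
      + volume.restrict Iᶜ) :
    F Set.univ = ∞ ∧
    (∫⁻ t, ENNReal.ofReal ((1 + t ^ 2)⁻¹) ∂F) < ∞ ∧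
    ∀ k, (∫⁻ t, (ENNReal.ofReal ((t - l (k + 1)) ^ 2))⁻¹ ∂F) < ∞ := by
  have hImeas : MeasurableSet Iᶜ := by
    rw [hIdef]
    exact ((measurableSet_lt measurable_const measurable_coe_real_ereal).inter
      measurableSet_Iio).compl
  have hlt : ∀ k, l k < μ₂ := fun k => by
    have := hlI k
    rw [hIdef] at this
    exact this.2
  have hwt : ∀ j k, (l (k + 1) - lj j k) ^ 2 ≤ 1 := fun j k => by
    have h1 := hlj1 j k
    have h2 := (hlj j k).2
    exact pow_le_one₀ (by linarith) h1.le
  have hwu : ∀ j k, u j k * (l (k + 1) - lj j k) ^ 2 ≤ u j k := fun j k =>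
    mul_le_of_le_one_right (hu j k).le (hwt j k)
  subst hFdef
  refine ⟨?_, ?_, fun k => ?_⟩
  · have hsub : Ici μ₂ ⊆ Iᶜ := by
      intro t ht htI
      rw [hIdef] at htI
      exact absurd htI.2 (not_lt.2 ht)
    have hvol : volume Iᶜ = ∞ := by
      rw [eq_top_iff, ← Real.volume_Ici (a := μ₂)]
      exact measure_mono hsub
    simp [hvol]
  · refine lintegral_sum_dirac_add_restrict_lt_top hImeas lj
      (fun j k => u j k * (l (k + 1) - lj j k) ^ 2) u (fun j k => (hu j k).le) husum hssum
      (fun t => ENNReal.ofReal ((1 + t ^ 2)⁻¹)) (C := 1) (c := 0) zero_le_one ?_ ?_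
    · intro j k
      have hw : 0 ≤ u j k * (l (k + 1) - lj j k) ^ 2 := mul_nonneg (hu j k).le (sq_nonneg _)
      rw [← ENNReal.ofReal_mul hw, one_mul]
      refine ENNReal.ofReal_le_ofReal ((mul_le_of_le_one_right hw ?_).trans (hwu j k))
      exact inv_le_one_of_one_le₀ (by nlinarith [sq_nonneg (lj j k)])
    · intro t _
      simp
  · obtain ⟨d, hd, hdS, hdatom⟩ : ∃ d > 0, (∀ t ∈ Iᶜ, d ≤ |t - l (k + 1)|) ∧
        ∀ j m, m ≠ k → d ≤ |lj j m - l (k + 1)| := by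
      have hfirst := hlj 0 (k + 1)
      refine ⟨min (l (k + 1) - l k) (lj 0 (k + 1) - l (k + 1)),
        lt_min (sub_pos.2 (hlmono k.lt_succ_self)) (sub_pos.2 hfirst.1), ?_, ?_⟩
      · intro t ht
        rcases le_or_gt t (l k) with h | h
        · exact (min_le_left _ _).trans (le_abs.2 (Or.inr (by linarith)))
        · have htμ : μ₂ ≤ t := by
            by_contra! hlt'
            apply ht
            have hk := hlI k
            rw [hIdef] at hk ⊢
            exact ⟨hk.1.trans (EReal.coe_lt_coe_iff.2 h), hlt'⟩
          have := hlt (k + 1 + 1)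
          exact (min_le_right _ _).trans (le_abs.2 (Or.inl (by linarith [hfirst.2])))
      · intro j m hm
        rcases lt_or_gt_of_ne hm with h | h
        · have h1 : l (m + 1) ≤ l k := hlmono.monotone h
          exact (min_le_left _ _).trans (le_abs.2 (Or.inr (by linarith [(hlj j m).2])))
        · refine (min_le_right _ _).trans (le_abs.2 (Or.inl (sub_le_sub_right ?_ _)))
          rcases (Nat.succ_le_of_lt h).eq_or_lt with rfl | h'
          · exact (strictMono_nat_of_lt_succ fun i => hljmono i (k + 1)).monotone j.zero_le
          · have h1 : l (k + 1 + 1) ≤ l m := hlmono.monotone h'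
            linarith [(hlj j m).1, hfirst.2]
    have hC : 0 ≤ 1 + (d ^ 2)⁻¹ := by positivity
    refine lintegral_sum_dirac_add_restrict_lt_top hImeas lj
      (fun j k => u j k * (l (k + 1) - lj j k) ^ 2) u (fun j k => (hu j k).le) husum hssum
      (fun t => (ENNReal.ofReal ((t - l (k + 1)) ^ 2))⁻¹) (c := l (k + 1)) hC ?_
      fun t ht => inv_ofReal_sq_le_of_le_abs hd (hdS t ht)
    intro j m
    have hw : 0 ≤ u j m * (l (m + 1) - lj j m) ^ 2 := mul_nonneg (hu j m).le (sq_nonneg _)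
    by_cases hm : m = k
    · subst hm
      have hpos : 0 < (lj j m - l (m + 1)) ^ 2 :=
        sq_pos_of_neg (sub_neg.2 (hlj j m).2)
      rw [← ENNReal.ofReal_inv_of_pos hpos, ← ENNReal.ofReal_mul hw]
      apply ENNReal.ofReal_le_ofReal
      rw [sub_sq_comm, mul_assoc, mul_inv_cancel₀ hpos.ne', mul_one]
      exact le_mul_of_one_le_left (hu j m).le (le_add_of_nonneg_right (by positivity))
    · refine (mul_le_mul_right (inv_ofReal_sq_le_of_le_abs hd (hdatom j m hm)) _).trans ?_
      rw [← ENNReal.ofReal_mul hw, mul_comm (1 + (d ^ 2)⁻¹) (u j m)]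
      apply ENNReal.ofReal_le_ofReal
      refine mul_le_mul (hwu j m) ?_ (by positivity) (hu j m).le
      exact mul_le_of_le_one_right hC
        (inv_le_one_of_one_le₀ (by nlinarith [sq_nonneg (lj j m - l (k + 1))]))
end

section
/- Let (F_j)_{j≥1} be strictly positive real numbers with ∑_{j≥1} (j+1)² F_j < ∞, and set s = ∑_{j≥1} F_j. Define the Borel measure F = ∑_{k≥1} ∑_{j≥1} F_j · δ_{k + 1/(j+1)} on ℝ, where δ_x denotes the Dirac measure at x. Then: (1) F([k, k+1)) = s for every integer k ≥ 1, and consequently F(ℝ) = ∞; (2) ∫_ℝ (1 + t²)^{-1} dF(t) < ∞; and (3) ∫_ℝ (t − m)^{-2} dF(t) < ∞ for every integer m ≥ 1. -/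
open Set Filter MeasureTheory
open scoped ENNReal

/-- The measure `∑_{k,j} c_j · δ_{(k+1) + 1/(j+2)}`. -/
noncomputable def atomicMeasure (c : ℕ → ℝ) : Measure ℝ :=
  Measure.sum fun k : ℕ => Measure.sum fun j : ℕ =>
    ENNReal.ofReal (c j) • Measure.dirac ((k : ℝ) + 1 + 1 / ((j : ℝ) + 2))

theorem lintegral_atomicMeasure (c : ℕ → ℝ) (f : ℝ → ℝ≥0∞) :
    ∫⁻ t, f t ∂atomicMeasure c =
      ∑' k : ℕ, ∑' j : ℕ, ENNReal.ofReal (c j) * f ((k : ℝ) + 1 + 1 / ((j : ℝ) + 2)) := by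
  simp only [atomicMeasure, lintegral_sum_measure, lintegral_smul_measure, lintegral_dirac,
    smul_eq_mul]

theorem atomicMeasure_apply (c : ℕ → ℝ) {A : Set ℝ} (hA : MeasurableSet A) :
    atomicMeasure c A = ∑' k : ℕ, ∑' j : ℕ,
      ENNReal.ofReal (c j) * A.indicator 1 ((k : ℝ) + 1 + 1 / ((j : ℝ) + 2)) := by
  rw [← lintegral_indicator_one hA, lintegral_atomicMeasure]

theorem one_div_add_two_pos (j : ℕ) : 0 < 1 / ((j : ℝ) + 2) := by positivity

theorem one_div_add_two_le_half (j : ℕ) : 1 / ((j : ℝ) + 2) ≤ 1 / 2 :=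
  one_div_le_one_div_of_le two_pos (by linarith [j.cast_nonneg (α := ℝ)])

theorem atom_mem_Ico_iff (i k j : ℕ) :
    (i : ℝ) + 1 + 1 / ((j : ℝ) + 2) ∈ Set.Ico ((k : ℝ) + 1) ((k : ℝ) + 2) ↔ i = k := by
  have h0 := one_div_add_two_pos j
  have h1 := one_div_add_two_le_half j
  constructor
  · rintro ⟨ha, hb⟩
    have hki : (k : ℝ) < (i + 1 : ℕ) := by push_cast; linarith
    have hik : (i : ℝ) < (k + 1 : ℕ) := by push_cast; linarith
    have := Nat.cast_lt.mp hki
    have := Nat.cast_lt.mp hik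
    omega
  · rintro rfl
    constructor <;> linarith

theorem atomicMeasure_Ico (c : ℕ → ℝ) (k : ℕ) :
    atomicMeasure c (Set.Ico ((k : ℝ) + 1) ((k : ℝ) + 2)) = ∑' j, ENNReal.ofReal (c j) := by
  rw [atomicMeasure_apply c measurableSet_Ico, tsum_eq_single k]
  · simp only [Set.indicator_of_mem ((atom_mem_Ico_iff k k _).2 rfl), Pi.one_apply, mul_one]
  · intro i hi
    simp only [Set.indicator_of_notMem (fun h => hi ((atom_mem_Ico_iff i k _).1 h)), mul_zero,
      tsum_zero]

theorem atomicMeasure_univ {c : ℕ → ℝ} (hc : 0 < c 0) : atomicMeasure c Set.univ = ∞ := by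
  rw [atomicMeasure_apply c MeasurableSet.univ]
  simp only [Set.indicator_univ, Pi.one_apply, mul_one]
  refine ENNReal.tsum_const_eq_top_of_ne_zero fun h => ?_
  exact (ENNReal.ofReal_pos.2 hc).ne' (ENNReal.tsum_eq_zero.1 h 0)

/-- A function bounded by `C (j+2)² / (k+1)²` at the atoms has finite integral. -/
theorem lintegral_atomicMeasure_lt_top {c : ℕ → ℝ} (hc : ∀ j, 0 ≤ c j)
    (hsum : Summable fun j : ℕ => ((j : ℝ) + 2) ^ 2 * c j) {f : ℝ → ℝ≥0∞} {C : ℝ} (hC : 0 ≤ C)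
    (hf : ∀ k j : ℕ, f ((k : ℝ) + 1 + 1 / ((j : ℝ) + 2)) ≤
      ENNReal.ofReal (C * ((j : ℝ) + 2) ^ 2 / ((k : ℝ) + 1) ^ 2)) :
    ∫⁻ t, f t ∂atomicMeasure c < ∞ := by
  have hk : Summable fun k : ℕ => C / ((k : ℝ) + 1) ^ 2 := by
    have := (summable_nat_add_iff 1).2 (Real.summable_one_div_nat_pow.2 one_lt_two)
    simpa [div_eq_mul_inv] using this.mul_left C
  calc ∫⁻ t, f t ∂atomicMeasure c
      ≤ ∑' k : ℕ, ∑' j : ℕ, ENNReal.ofReal (C / ((k : ℝ) + 1) ^ 2) *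
          ENNReal.ofReal (((j : ℝ) + 2) ^ 2 * c j) := by
        rw [lintegral_atomicMeasure]
        refine ENNReal.tsum_le_tsum fun k => ENNReal.tsum_le_tsum fun j => ?_
        refine (mul_le_mul_right (hf k j) _).trans_eq ?_
        rw [← ENNReal.ofReal_mul (hc j), ← ENNReal.ofReal_mul (by positivity)]
        congr 1
        ring
    _ = (∑' k : ℕ, ENNReal.ofReal (C / ((k : ℝ) + 1) ^ 2)) *
          ∑' j : ℕ, ENNReal.ofReal (((j : ℝ) + 2) ^ 2 * c j) := by
        simp only [ENNReal.tsum_mul_left, ENNReal.tsum_mul_right]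
    _ < ∞ := ENNReal.mul_lt_top hk.tsum_ofReal_lt_top hsum.tsum_ofReal_lt_top

theorem sq_mul_one_add_sq_le {d x : ℝ} (hx : 0 < x) (hx' : x ≤ 1 / 2)
    (hd : d = 0 ∨ 1 ≤ d ∨ d ≤ -1) : x ^ 2 * (1 + d ^ 2) ≤ 2 * (d + x) ^ 2 := by
  have hx2 : x ^ 2 ≤ 1 / 4 := by nlinarith
  have hxd : x ^ 2 * (1 + d ^ 2) ≤ 1 / 4 * (1 + d ^ 2) := by gcongr
  rcases hd with rfl | hd | hd
  · nlinarith
  · nlinarith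
  · nlinarith [mul_nonneg (by linarith : 0 ≤ -d - 1) (by linarith : 0 ≤ 1 / 2 - x)]

theorem add_one_sq_le (k m : ℝ) : (k + 1) ^ 2 ≤ 4 * (1 + m ^ 2) * (1 + (k - m) ^ 2) := by
  nlinarith [sq_nonneg (k - 1), sq_nonneg (k - 2 * m), sq_nonneg (m * (k - m)), sq_nonneg m]

theorem inv_ofReal_atom_sub_sq_le (k j m : ℕ) :
    (ENNReal.ofReal (((k : ℝ) + 1 + 1 / ((j : ℝ) + 2) - ((m : ℝ) + 1)) ^ 2))⁻¹ ≤
      ENNReal.ofReal (8 * (1 + (m : ℝ) ^ 2) * ((j : ℝ) + 2) ^ 2 / ((k : ℝ) + 1) ^ 2) := by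
  have hd : (k : ℝ) - m = 0 ∨ 1 ≤ (k : ℝ) - m ∨ (k : ℝ) - m ≤ -1 := by
    rcases lt_trichotomy k m with h | rfl | h
    · have : ((k + 1 : ℕ) : ℝ) ≤ m := Nat.cast_le.2 h
      push_cast at this
      right; right; linarith
    · left; ring
    · have : ((m + 1 : ℕ) : ℝ) ≤ k := Nat.cast_le.2 h
      push_cast at this
      right; left; linarith
  have h1 := sq_mul_one_add_sq_le (one_div_add_two_pos j) (one_div_add_two_le_half j) hd
  have h2 := add_one_sq_le (k : ℝ) m
  rw [show (k : ℝ) + 1 + 1 / ((j : ℝ) + 2) - ((m : ℝ) + 1) = (k : ℝ) - m + 1 / ((j : ℝ) + 2) by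
    ring]
  have hlower : ((k : ℝ) + 1) ^ 2 / (8 * (1 + (m : ℝ) ^ 2) * ((j : ℝ) + 2) ^ 2) ≤
      ((k : ℝ) - m + 1 / ((j : ℝ) + 2)) ^ 2 := by
    calc ((k : ℝ) + 1) ^ 2 / (8 * (1 + (m : ℝ) ^ 2) * ((j : ℝ) + 2) ^ 2)
        ≤ 4 * (1 + (m : ℝ) ^ 2) * (1 + ((k : ℝ) - m) ^ 2) /
            (8 * (1 + (m : ℝ) ^ 2) * ((j : ℝ) + 2) ^ 2) := by gcongr
      _ = (1 / ((j : ℝ) + 2)) ^ 2 * (1 + ((k : ℝ) - m) ^ 2) / 2 := by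
          field_simp
          ring
      _ ≤ _ := by linarith
  have hpos : 0 < ((k : ℝ) + 1) ^ 2 / (8 * (1 + (m : ℝ) ^ 2) * ((j : ℝ) + 2) ^ 2) := by
    positivity
  rw [← ENNReal.ofReal_inv_of_pos (hpos.trans_le hlower)]
  exact ENNReal.ofReal_le_ofReal ((inv_anti₀ hpos hlower).trans_eq (inv_div _ _))

theorem inv_one_add_atom_sq_le (k j : ℕ) :
    (1 + ((k : ℝ) + 1 + 1 / ((j : ℝ) + 2)) ^ 2)⁻¹ ≤
      1 * ((j : ℝ) + 2) ^ 2 / ((k : ℝ) + 1) ^ 2 := by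
  have hx := one_div_add_two_pos j
  have hk := k.cast_nonneg (α := ℝ)
  have hj := j.cast_nonneg (α := ℝ)
  calc (1 + ((k : ℝ) + 1 + 1 / ((j : ℝ) + 2)) ^ 2)⁻¹ ≤ (((k : ℝ) + 1) ^ 2)⁻¹ :=
        inv_anti₀ (by positivity) (by nlinarith)
    _ = 1 / ((k : ℝ) + 1) ^ 2 := (one_div _).symm
    _ ≤ _ := by
        gcongr
        nlinarith

/-- let `(F_j)_{j≥1}` be strictly positive reals with
`∑_{j≥1} (j+1)² F_j < ∞` and `s = ∑_{j≥1} F_j`. Here `c j` denotes `F_{j+1}`, so the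
atoms `k + 1/(j+1)` (for `j, k ≥ 1`) become `(k+1) + 1/(j+2)` (for `j, k ≥ 0`) and the
weight condition reads `∑_j (j+2)² c_j < ∞`. For the measure
`F = ∑_{k,j} c_j · δ_{(k+1) + 1/(j+2)}` one has: (1) `F([k, k+1)) = s` for every integer
`k ≥ 1`, hence `F(ℝ) = ∞`; (2) `∫ (1+t²)⁻¹ dF < ∞`; (3) `∫ (t − m)⁻² dF < ∞` for every
integer `m ≥ 1`. -/
theorem stmt11 (c : ℕ → ℝ) (hc : ∀ j, 0 < c j)
    (hsum : Summable fun j : ℕ => ((j : ℝ) + 2) ^ 2 * c j)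
    (s : ℝ) (hs : s = ∑' j, c j)
    (F : Measure ℝ)
    (hFdef : F = Measure.sum fun k : ℕ => Measure.sum fun j : ℕ =>
        ENNReal.ofReal (c j) • Measure.dirac ((k : ℝ) + 1 + 1 / ((j : ℝ) + 2))) :
    (∀ k : ℕ, F (Set.Ico ((k : ℝ) + 1) ((k : ℝ) + 2)) = ENNReal.ofReal s) ∧
    F Set.univ = ∞ ∧
    (∫⁻ t, ENNReal.ofReal ((1 + t ^ 2)⁻¹) ∂F) < ∞ ∧
    ∀ m : ℕ, (∫⁻ t, (ENNReal.ofReal ((t - ((m : ℝ) + 1)) ^ 2))⁻¹ ∂F) < ∞ := by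
  have hc' j := (hc j).le
  have hcs : Summable c := hsum.of_nonneg_of_le hc' fun j => by
    have hj := j.cast_nonneg (α := ℝ)
    exact le_mul_of_one_le_left (hc' j) (by nlinarith)
  change F = atomicMeasure c at hFdef
  subst hFdef hs
  refine ⟨fun k => ?_, atomicMeasure_univ (hc 0), ?_, fun m => ?_⟩
  · rw [atomicMeasure_Ico, ENNReal.ofReal_tsum_of_nonneg hc' hcs]
  · exact lintegral_atomicMeasure_lt_top hc' hsum zero_le_one fun k j =>
      ENNReal.ofReal_le_ofReal (inv_one_add_atom_sq_le k j)
  · exact lintegral_atomicMeasure_lt_top hc' hsum (by positivity) fun k j =>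
      inv_ofReal_atom_sub_sq_le k j m
end
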